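/- Let Ω ∈ K^n/ℤ^n be an orbit with 𝔻_Ω = ∅ and let 𝔪 = 𝔪_λ ∈ Ω. For every ideal I of D_n with 𝔪 ⊇ I ⊇ 𝔪^i for some i ≥ 1, the 𝕀_n-module V(I) := B_n ⊗_{D_n} D_n/I is an indecomposable, equidimensional, generalized weight 𝕀_n-module of length d := dim_K(D_n/I) < ∞; it is isomorphic to B_n/B_nI = ⊕_{α∈ℤ^n} ∂^α D_n/I, satisfies dim_K V(I)^𝔫 = d for all 𝔫 ∈ Ω, and ann_{𝕀_n}(V(I)) = 𝔞_n. -/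

import Mathlib

set_option maxHeartbeats 1000000
set_option synthInstance.maxHeartbeats 400000
set_option linter.unusedSectionVars false

namespace IDO

open scoped TensorProduct

noncomputable section

variable (K : Type*) [Field K] [CharZero K] (n : ℕ)

/-- The polynomial algebra `P_n = K[x_1, …, x_n]`. -/
abbrev P := MvPolynomial (Fin n) K

/-- The multiplication operator `x_i`. -/
def xOp (i : Fin n) : Module.End K (P K n) := LinearMap.mulLeft K (MvPolynomial.X i)

/-- The partial derivative `∂_i`. -/
def dOp (i : Fin n) : Module.End K (P K n) := (MvPolynomial.pderiv i).toLinearMap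

/-- The integration operator `∫_i`, sending `x^α ↦ x^{α+e_i}/(α_i+1)`. -/
def intOp (i : Fin n) : Module.End K (P K n) :=
  ((MvPolynomial.basisMonomials (Fin n) K).constr K)
    (fun α => (((α i : ℕ) : K) + 1)⁻¹ •
      (MvPolynomial.monomial (α + Finsupp.single i 1) (1 : K)))

/-- The algebra of polynomial integro-differential operators `𝕀_n`, as a subalgebra of
`End_K(P_n)` generated by the `x_i`, `∂_i` and `∫_i`. -/
def InSub : Subalgebra K (Module.End K (P K n)) :=
  Algebra.adjoin K (Set.range (xOp K n) ∪ Set.range (dOp K n) ∪ Set.range (intOp K n))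

/-- The algebra `𝕀_n` (as a type, with its canonical ring structure). -/
def In : Type _ := InSub K n

instance : Ring (In K n) := inferInstanceAs (Ring (InSub K n))
instance : Algebra K (In K n) := inferInstanceAs (Algebra K (InSub K n))
instance : Module (In K n) (P K n) := inferInstanceAs (Module (InSub K n) (P K n))
instance : IsScalarTower K (In K n) (P K n) :=
  inferInstanceAs (IsScalarTower K (InSub K n) (P K n))

/-- `x_i` as an element of `𝕀_n`. -/
def xEl (i : Fin n) : In K n :=
  show InSub K n from
    ⟨xOp K n i, Algebra.subset_adjoin (Set.mem_union_left _ (Set.mem_union_left _ ⟨i, rfl⟩))⟩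

/-- `∂_i` as an element of `𝕀_n`. -/
def dEl (i : Fin n) : In K n :=
  show InSub K n from
    ⟨dOp K n i, Algebra.subset_adjoin (Set.mem_union_left _ (Set.mem_union_right _ ⟨i, rfl⟩))⟩

/-- `∫_i` as an element of `𝕀_n`. -/
def intEl (i : Fin n) : In K n :=
  show InSub K n from
    ⟨intOp K n i, Algebra.subset_adjoin (Set.mem_union_right _ ⟨i, rfl⟩)⟩

/-- `H_i = ∂_i x_i` as an element of `𝕀_n`. -/
def HEl (i : Fin n) : In K n := dEl K n i * xEl K n i

section Modules

variable (M : Type*) [AddCommGroup M] [Module K M] [Module (In K n) M]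
  [IsScalarTower K (In K n) M]

/-- The weight space `M_λ = {m | H_i m = λ_i m for all i}`. -/
def weightSpace (lam : Fin n → K) : Submodule K M where
  carrier := {m | ∀ i, HEl K n i • m = lam i • m}
  add_mem' := by
    intro a b ha hb i
    rw [smul_add, ha i, hb i, smul_add]
  zero_mem' := by intro i; simp
  smul_mem' := by
    intro c m hm i
    rw [← smul_comm c (HEl K n i) m, hm i, smul_smul, mul_comm, ← smul_smul]

private lemma pow_smul_zero_mono {a : In K n} {m : M} {s s' : ℕ}
    (h : (a ^ s) • m = 0) (hle : s ≤ s') : (a ^ s') • m = 0 := by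
  obtain ⟨k, rfl⟩ := Nat.exists_eq_add_of_le hle
  rw [add_comm s k, pow_add, mul_smul, h, smul_zero]

/-- The generalized weight space `M^λ = {m | (H_i − λ_i)^N m = 0 for some N and all i}`. -/
def genWeightSpace (lam : Fin n → K) : Submodule K M where
  carrier := {m | ∃ N : ℕ, ∀ i,
    ((HEl K n i - algebraMap K (In K n) (lam i)) ^ N) • m = 0}
  add_mem' := by
    rintro a b ⟨Na, ha⟩ ⟨Nb, hb⟩
    refine ⟨Na ⊔ Nb, fun i => ?_⟩
    rw [smul_add, pow_smul_zero_mono K n M (ha i) le_sup_left,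
      pow_smul_zero_mono K n M (hb i) le_sup_right, add_zero]
  zero_mem' := ⟨0, fun i => smul_zero _⟩
  smul_mem' := by
    rintro c m ⟨N, hN⟩
    exact ⟨N, fun i => by rw [← smul_comm c _ m, hN i, smul_zero]⟩

/-- `M` is a weight module: `M = ⊕_λ M_λ`. -/
def IsWeightModule : Prop :=
  letI := Classical.decEq (Fin n → K)
  DirectSum.IsInternal (fun lam : Fin n → K => weightSpace K n M lam)

/-- `M` is a generalized weight module: `M = ⊕_λ M^λ`. -/
def IsGenWeightModule : Prop :=
  letI := Classical.decEq (Fin n → K)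
  DirectSum.IsInternal (fun lam : Fin n → K => genWeightSpace K n M lam)

/-- The support `Supp(M) = {λ | M^λ ≠ 0}`. -/
def supp : Set (Fin n → K) := {lam | genWeightSpace K n M lam ≠ ⊥}

/-- `M` is an indecomposable `𝕀_n`-module. -/
def IsIndecomposableMod : Prop :=
  Nontrivial M ∧ ∀ p q : Submodule (In K n) M, IsCompl p q → p = ⊥ ∨ q = ⊥

/-- The annihilator of an `𝕀_n`-module, as a set. -/
def annSet : Set (In K n) := {a | ∀ m : M, a • m = 0}

end Modules

/-- A prime (two-sided) ideal of the noncommutative ring `𝕀_n`, given as a set: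
`S ≠ 𝕀_n` and `a 𝕀_n b ⊆ S → a ∈ S ∨ b ∈ S`. -/
def IsPrimeSet (S : Set (In K n)) : Prop :=
  S ≠ Set.univ ∧ ∀ a b : In K n, (∀ r : In K n, a * r * b ∈ S) → a ∈ S ∨ b ∈ S

-- orbits
/-- The `ℤ^n`-orbit of `λ ∈ K^n`. -/
def orbitOf (lam : Fin n → K) : Set (Fin n → K) :=
  {mu | ∀ i, ∃ z : ℤ, mu i - lam i = (z : K)}

/-- The setoid on `K^n` whose classes are the `ℤ^n`-orbits. -/
def orbitSetoid : Setoid (Fin n → K) where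
  r mu nu := ∀ i, ∃ z : ℤ, mu i - nu i = (z : K)
  iseqv := by
    constructor
    · intro x i; exact ⟨0, by simp⟩
    · intro x y h i
      obtain ⟨z, hz⟩ := h i
      exact ⟨-z, by push_cast; linear_combination -hz⟩
    · intro x y z hxy hyz i
      obtain ⟨a, ha⟩ := hxy i
      obtain ⟨b, hb⟩ := hyz i
      exact ⟨a + b, by push_cast; linear_combination ha + hb⟩

/-- `𝔻_Ω = {i | Ω_i = ℤ}` for the orbit `Ω` of `λ`. -/
def DD (lam : Fin n → K) : Set (Fin n) := {i | ∃ z : ℤ, lam i = (z : K)}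

/-- `λ` is the normalized representative of its orbit: integer coordinates are `0`. -/
def IsNormalized (lam : Fin n → K) : Prop := ∀ i, (∃ z : ℤ, lam i = (z : K)) → lam i = 0


-- I_1 specifics
/-- The matrix units `e_{st} = ∫^s ∂^t − ∫^{s+1} ∂^{t+1}` of `𝕀_1`. -/
def eEl1 (s t : ℕ) : In K 1 :=
  intEl K 1 0 ^ s * dEl K 1 0 ^ t - intEl K 1 0 ^ (s + 1) * dEl K 1 0 ^ (t + 1)

/-- `F = ⊕ K e_{st}`, the unique proper two-sided ideal of `𝕀_1`, here as the left ideal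
generated by the `e_{st}` (the two coincide). -/
def Fideal : Submodule (In K 1) (In K 1) :=
  Submodule.span (In K 1) {a | ∃ s t : ℕ, a = eEl1 K s t}

/-- The left ideal `F + 𝕀_1 (H − μ)^s`. -/
def MslIdeal (s : ℕ) (mu : K) : Submodule (In K 1) (In K 1) :=
  Fideal K ⊔ Submodule.span (In K 1) {(HEl K 1 0 - algebraMap K (In K 1) mu) ^ s}

/-- The `𝕀_1`-module `M(s,μ) = 𝕀_1/(F + 𝕀_1 (H − μ)^s)`. -/
def Msl (s : ℕ) (mu : K) := (In K 1) ⧸ MslIdeal K s mu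

instance (s : ℕ) (mu : K) : AddCommGroup (Msl K s mu) :=
  inferInstanceAs (AddCommGroup ((In K 1) ⧸ MslIdeal K s mu))
instance (s : ℕ) (mu : K) : Module (In K 1) (Msl K s mu) :=
  inferInstanceAs (Module (In K 1) ((In K 1) ⧸ MslIdeal K s mu))
instance (s : ℕ) (mu : K) : Module K (Msl K s mu) :=
  inferInstanceAs (Module K ((In K 1) ⧸ MslIdeal K s mu))
instance (s : ℕ) (mu : K) : IsScalarTower K (In K 1) (Msl K s mu) :=
  inferInstanceAs (IsScalarTower K (In K 1) ((In K 1) ⧸ MslIdeal K s mu))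

-- two-sided ideals of I_n
/-- The element `e_{st}(i) ∈ 𝕀_n` built from the `i`-th tensor factor. -/
def eElN (i : Fin n) (s t : ℕ) : In K n :=
  intEl K n i ^ s * dEl K n i ^ t - intEl K n i ^ (s + 1) * dEl K n i ^ (t + 1)

/-- The height one prime `𝔭_i`, the two-sided ideal of `𝕀_n` generated by `F(i)`. -/
def pIdeal (i : Fin n) : TwoSidedIdeal (In K n) :=
  TwoSidedIdeal.span {a | ∃ s t : ℕ, a = eElN K n i s t}

/-- `𝔞_n(I) = Σ_{i ∈ I} 𝔭_i`. -/
def aIdeal (I : Set (Fin n)) : TwoSidedIdeal (In K n) := ⨆ i ∈ I, pIdeal K n i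


-- bundled modules
universe u

/-- A bundled `𝕀_n`-module (with compatible `K`-structure). -/
structure ModN (K : Type u) [Field K] [CharZero K] (n : ℕ) : Type (u + 1) where
  carrier : Type u
  [instAdd : AddCommGroup carrier]
  [instK : Module K carrier]
  [instIn : Module (In K n) carrier]
  [instTower : IsScalarTower K (In K n) carrier]

attribute [instance] ModN.instAdd ModN.instK ModN.instIn ModN.instTower

/-- The endomorphism of `M_1 ⊗ ⋯ ⊗ M_n` acting by `a ∈ 𝕀_1` on the `i`-th factor. -/
def tprodMap (Mi : Fin n → ModN K 1) (i : Fin n) (a : In K 1) :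
    (⨂[K] j, (Mi j).carrier) →ₗ[K] ⨂[K] j, (Mi j).carrier :=
  PiTensorProduct.map (Function.update
    (fun j => (LinearMap.id : (Mi j).carrier →ₗ[K] (Mi j).carrier)) i
    (DistribMulAction.toLinearMap K ((Mi i).carrier) a))

/-- The `𝕀_n`-module `M` "is" the tensor product `M_1 ⊗ ⋯ ⊗ M_n` of the `𝕀_1`-modules `M_i`:
there is a `K`-linear isomorphism under which the generators `x_i, ∂_i, ∫_i` of `𝕀_n` act on
the `i`-th tensor factor via the corresponding generators of `𝕀_1`. -/
def RealizesTensor (Mi : Fin n → ModN K 1) (M : Type*) [AddCommGroup M] [Module K M]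
    [Module (In K n) M] [IsScalarTower K (In K n) M] : Prop :=
  ∃ φ : M ≃ₗ[K] ⨂[K] j, (Mi j).carrier,
    ∀ (i : Fin n) (m : M),
      φ (xEl K n i • m) = tprodMap K n Mi i (xEl K 1 0) (φ m) ∧
      φ (dEl K n i • m) = tprodMap K n Mi i (dEl K 1 0) (φ m) ∧
      φ (intEl K n i • m) = tprodMap K n Mi i (intEl K 1 0) (φ m)

/-- `M` is (isomorphic to) the simple weight module `M(𝒟_Ω)` attached to the orbit of `λ`
and the subset `𝒟 ⊆ 𝔻_Ω`: the tensor product of copies of `K[x]` (for `i ∈ 𝒟`) and of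
`M(1, λ_i)` (for `i ∉ 𝒟`). -/
def RealizesMD (lam : Fin n → K) (D : Set (Fin n)) (M : Type*) [AddCommGroup M] [Module K M]
    [Module (In K n) M] [IsScalarTower K (In K n) M] : Prop :=
  ∃ Mi : Fin n → ModN K 1,
    (∀ i, i ∈ D → Nonempty ((Mi i).carrier ≃ₗ[In K 1] P K 1)) ∧
    (∀ i, i ∉ D → Nonempty ((Mi i).carrier ≃ₗ[In K 1] Msl K 1 (lam i))) ∧
    RealizesTensor K n Mi M

/-- `M` is (isomorphic to) the module `P_{n-1} ⊗ M(s, λ)` (with the copy of `M(s,λ)` placed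
in position `j`). -/
def RealizesPMs (lam : Fin n → K) (j : Fin n) (s : ℕ) (M : Type*) [AddCommGroup M] [Module K M]
    [Module (In K n) M] [IsScalarTower K (In K n) M] : Prop :=
  ∃ Mi : Fin n → ModN K 1,
    (∀ i, i ≠ j → Nonempty ((Mi i).carrier ≃ₗ[In K 1] P K 1)) ∧
    Nonempty ((Mi j).carrier ≃ₗ[In K 1] Msl K s (lam j)) ∧
    RealizesTensor K n Mi M

/-- Membership in the category `GW(𝕀_n, 𝒟_Ω)`: generalized weight modules with support in the
orbit of `λ` all of whose simple subquotients are isomorphic to `M(𝒟_Ω)`. -/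
def InGWD (lam : Fin n → K) (D : Set (Fin n)) (M : Type*) [AddCommGroup M] [Module K M]
    [Module (In K n) M] [IsScalarTower K (In K n) M] : Prop :=
  IsGenWeightModule K n M ∧ supp K n M ⊆ orbitOf K n lam ∧
  ∀ (p q : Submodule (In K n) M), p ≤ q →
    IsSimpleModule (In K n) (q ⧸ Submodule.comap q.subtype p) →
    RealizesMD K n lam D (q ⧸ Submodule.comap q.subtype p)

/-- The support `S(𝒟_Ω) = ℕ_+^{𝒟_Ω} × ∏_{i ∉ 𝒟_Ω} (λ_i + ℤ)` of the module `M(𝒟_Ω)`. -/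
def SuppMD (lam : Fin n → K) (D : Set (Fin n)) : Set (Fin n → K) :=
  {mu | (∀ i ∈ D, ∃ m : ℕ, 0 < m ∧ mu i = (m : K)) ∧
        (∀ i ∉ D, ∃ z : ℤ, mu i = lam i + (z : K))}

/-- `M` is an absolutely prime `𝕀_n`-module: its annihilator is a prime ideal and every
nonzero subfactor of `M` has the same annihilator. -/
def IsAbsolutelyPrime (M : Type*) [AddCommGroup M] [Module K M]
    [Module (In K n) M] [IsScalarTower K (In K n) M] : Prop :=
  IsPrimeSet K n (annSet K n M) ∧
  ∀ (p q : Submodule (In K n) M), p ≤ q →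
    Nontrivial (q ⧸ Submodule.comap q.subtype p) →
    annSet K n (q ⧸ Submodule.comap q.subtype p) = annSet K n M


-- the commutative subalgebra D_n = K[H_1, …, H_n]
lemma xEl_smul (i : Fin n) (p : P K n) : xEl K n i • p = MvPolynomial.X i * p := rfl

lemma dEl_smul (i : Fin n) (p : P K n) : dEl K n i • p = MvPolynomial.pderiv i p := rfl

lemma hEl_monomial (i : Fin n) (α : Fin n →₀ ℕ) (c : K) :
    HEl K n i • (MvPolynomial.monomial α c : P K n)
      = (((α i : ℕ) : K) + 1) • MvPolynomial.monomial α c := by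
  have hx : xEl K n i • (MvPolynomial.monomial α c : P K n)
      = MvPolynomial.monomial (α + Finsupp.single i 1) c := by
    rw [xEl_smul, MvPolynomial.X, MvPolynomial.monomial_mul, one_mul, add_comm]
  rw [HEl, mul_smul, hx, dEl_smul, MvPolynomial.pderiv_monomial,
    add_tsub_cancel_right, MvPolynomial.smul_monomial, Finsupp.add_apply,
    Finsupp.single_eq_same, smul_eq_mul]
  congr 1
  push_cast
  ring

private lemma In_ext {a b : In K n} (h : ∀ p : P K n, a • p = b • p) : a = b := by
  have : (show InSub K n from a) = (show InSub K n from b) :=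
    Subtype.ext (LinearMap.ext fun p => h p)
  exact this

lemma hEl_comm (i j : Fin n) : HEl K n i * HEl K n j = HEl K n j * HEl K n i := by
  apply In_ext
  intro p
  induction p using MvPolynomial.induction_on' with
  | monomial α c =>
      have key : ∀ a b : Fin n, (HEl K n a * HEl K n b) • (MvPolynomial.monomial α c : P K n)
          = ((((α b : ℕ) : K) + 1) * (((α a : ℕ) : K) + 1)) • MvPolynomial.monomial α c := by
        intro a b
        rw [mul_smul, hEl_monomial, ← smul_comm, hEl_monomial, smul_smul]
      rw [key, key, mul_comm]
  | add p q hp hq =>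
      rw [smul_add, smul_add, hp, hq]

/-- `D_n = K[H_1, …, H_n]` as a subalgebra of `𝕀_n`. -/
def DnSub : Subalgebra K (In K n) := Algebra.adjoin K (Set.range (HEl K n))

/-- The commutative algebra `D_n` (as a type). -/
def Dn : Type _ := DnSub K n

instance : CommRing (Dn K n) :=
  Algebra.adjoinCommRingOfComm K (by rintro a ⟨i, rfl⟩ b ⟨j, rfl⟩; exact hEl_comm K n i j)

instance : Algebra K (Dn K n) := inferInstanceAs (Algebra K (DnSub K n))

/-- The inclusion `D_n → 𝕀_n`. -/
def dnVal : Dn K n →+* In K n := ((DnSub K n).val : DnSub K n →ₐ[K] In K n).toRingHom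

/-- `H_i` as an element of `D_n`. -/
def HElD (i : Fin n) : Dn K n :=
  show DnSub K n from ⟨HEl K n i, Algebra.subset_adjoin ⟨i, rfl⟩⟩

lemma dn_comm (d : Dn K n) (i : Fin n) :
    dnVal K n d * HEl K n i = HEl K n i * dnVal K n d := by
  have h1 : DnSub K n ≤ Subalgebra.centralizer K (Set.range (HEl K n)) := by
    apply Algebra.adjoin_le
    rintro x ⟨j, rfl⟩
    rw [SetLike.mem_coe, Subalgebra.mem_centralizer_iff]
    rintro g ⟨i', rfl⟩
    exact hEl_comm K n i' j
  have h2 := (Subalgebra.mem_centralizer_iff K).mp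
    (h1 (show DnSub K n from d).2) (HEl K n i) ⟨i, rfl⟩
  exact h2.symm


section DnModules

variable (M : Type*) [AddCommGroup M] [Module K M] [Module (In K n) M]
  [IsScalarTower K (In K n) M]

lemma genWS_stable (lam : Fin n → K) {m : M} (hm : m ∈ genWeightSpace K n M lam)
    (d : Dn K n) : dnVal K n d • m ∈ genWeightSpace K n M lam := by
  obtain ⟨N, hN⟩ := hm
  refine ⟨N, fun i => ?_⟩
  have hc : Commute (dnVal K n d) ((HEl K n i - algebraMap K (In K n) (lam i)) ^ N) := by
    apply Commute.pow_right
    exact Commute.sub_right (dn_comm K n d i) ((Algebra.commutes (lam i) (dnVal K n d)).symm)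
  rw [← mul_smul, ← hc.eq, mul_smul, hN i, smul_zero]

instance genWS_smul (lam : Fin n → K) : SMul (Dn K n) (genWeightSpace K n M lam) :=
  ⟨fun d w => ⟨dnVal K n d • (w : M), genWS_stable K n M lam w.2 d⟩⟩

instance genWS_module (lam : Fin n → K) : Module (Dn K n) (genWeightSpace K n M lam) :=
  Module.ofMinimalAxioms
    (fun d x y => Subtype.ext (smul_add (dnVal K n d) (x : M) (y : M)))
    (fun d d' x => Subtype.ext (show dnVal K n (d + d') • (x : M)
      = dnVal K n d • (x : M) + dnVal K n d' • (x : M) by rw [map_add, add_smul]))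
    (fun d d' x => Subtype.ext (show dnVal K n (d * d') • (x : M)
      = dnVal K n d • (dnVal K n d' • (x : M)) by rw [map_mul, mul_smul]))
    (fun x => Subtype.ext (show dnVal K n 1 • (x : M) = (x : M) by rw [map_one, one_smul]))

instance genWS_tower (lam : Fin n → K) :
    IsScalarTower K (Dn K n) (genWeightSpace K n M lam) :=
  ⟨fun c d w => Subtype.ext (show dnVal K n (c • d) • (w : M) = c • (dnVal K n d • (w : M)) by
    rw [show dnVal K n (c • d) = c • dnVal K n d from map_smul (DnSub K n).val c d, smul_assoc])⟩

end DnModules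

/-- The maximal ideal `𝔪_λ = (H_1 − λ_1, …, H_n − λ_n)` of `D_n`. -/
def mIdeal (lam : Fin n → K) : Ideal (Dn K n) :=
  Ideal.span {d | ∃ i, d = HElD K n i - algebraMap K (Dn K n) (lam i)}

/-- The category `LF_𝔪(D_n)` of `𝔪_λ`-locally finite `D_n`-modules: every cyclic submodule is
finite dimensional over `K` and annihilated by a power of `𝔪_λ`. -/
def IsLF (lam : Fin n → K) (N : Type*) [AddCommGroup N] [Module K N] [Module (Dn K n) N]
    [IsScalarTower K (Dn K n) N] : Prop :=
  ∀ x : N, FiniteDimensional K ((Submodule.span (Dn K n) {x}).restrictScalars K) ∧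
    ∃ s : ℕ, ∀ i, ((HElD K n i - algebraMap K (Dn K n) (lam i)) ^ s) • x = 0

-- the algebra B_n = 𝕀_n/𝔞_n
/-- The maximal ideal `𝔞_n = 𝔭_1 + ⋯ + 𝔭_n` of `𝕀_n`. -/
def aFull : TwoSidedIdeal (In K n) := aIdeal K n Set.univ

/-- The skew Laurent polynomial algebra `B_n = 𝕀_n/𝔞_n`. -/
def Bn : Type _ := (aFull K n).ringCon.Quotient

instance : Ring (Bn K n) := inferInstanceAs (Ring (aFull K n).ringCon.Quotient)

/-- The quotient map `𝕀_n → B_n`. -/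
def toBn : In K n →+* Bn K n := RingCon.mk' _

lemma toBn_surjective : Function.Surjective (toBn K n) :=
  Quotient.mk''_surjective

/-- The composite `D_n → 𝕀_n → B_n`. -/
def bnD : Dn K n →+* Bn K n := (toBn K n).comp (dnVal K n)

/-- `B_n` as a right `D_n`-module (written as a left module structure, `d • b = b ⬝ d`). -/
instance : SMul (Dn K n) (Bn K n) := ⟨fun d b => b * bnD K n d⟩

instance : Module (Dn K n) (Bn K n) :=
  Module.ofMinimalAxioms
    (fun d x y => show (x + y) * bnD K n d = x * bnD K n d + y * bnD K n d from add_mul _ _ _)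
    (fun d d' x => show x * bnD K n (d + d') = x * bnD K n d + x * bnD K n d' by
      rw [map_add, mul_add])
    (fun d d' x => show x * bnD K n (d * d') = (x * bnD K n d') * bnD K n d by
      rw [mul_comm d d', map_mul, ← mul_assoc])
    (fun x => show x * bnD K n 1 = x by rw [map_one, mul_one])

instance : SMulCommClass (Dn K n) (Bn K n) (Bn K n) :=
  ⟨fun d b m => show (b * m) * bnD K n d = b * (m * bnD K n d) from mul_assoc b m (bnD K n d)⟩

/-- The induced module `B_n ⊗_{D_n} N` of a `D_n`-module `N`. -/
def Ind (N : Type*) [AddCommGroup N] [Module (Dn K n) N] : Type _ :=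
  (Bn K n) ⊗[Dn K n] N

section Ind

variable (N : Type*) [AddCommGroup N] [Module (Dn K n) N]

instance : AddCommGroup (Ind K n N) :=
  inferInstanceAs (AddCommGroup ((Bn K n) ⊗[Dn K n] N))

instance indModuleBn : Module (Bn K n) (Ind K n N) :=
  inferInstanceAs (Module (Bn K n) ((Bn K n) ⊗[Dn K n] N))

instance indModuleDn : Module (Dn K n) (Ind K n N) :=
  inferInstanceAs (Module (Dn K n) ((Bn K n) ⊗[Dn K n] N))

instance indModuleIn : Module (In K n) (Ind K n N) := Module.compHom _ (toBn K n)

instance indModuleK : Module K (Ind K n N) := Module.compHom _ (algebraMap K (Dn K n))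

lemma bn_algebraMap_comm (c : K) (u : Bn K n) :
    toBn K n (algebraMap K (In K n) c) * u = u * toBn K n (algebraMap K (In K n) c) := by
  obtain ⟨r, rfl⟩ := toBn_surjective K n u
  rw [← map_mul, ← map_mul, Algebra.commutes]

lemma dnVal_algebraMap (c : K) :
    dnVal K n (algebraMap K (Dn K n) c) = algebraMap K (In K n) c :=
  AlgHom.commutes (DnSub K n).val c

lemma ind_key (c : K) (w : (Bn K n) ⊗[Dn K n] N) :
    (toBn K n (algebraMap K (In K n) c)) • w = (algebraMap K (Dn K n) c) • w := by
  induction w using TensorProduct.induction_on with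
  | zero => rw [smul_zero, smul_zero]
  | tmul b x =>
      rw [TensorProduct.smul_tmul', TensorProduct.smul_tmul']
      congr 1
      show toBn K n (algebraMap K (In K n) c) * b = b * bnD K n (algebraMap K (Dn K n) c)
      have h1 : bnD K n (algebraMap K (Dn K n) c) = toBn K n (algebraMap K (In K n) c) := by
        show toBn K n (dnVal K n (algebraMap K (Dn K n) c)) = _
        rw [dnVal_algebraMap]
      rw [h1, bn_algebraMap_comm]
  | add x y hx hy => rw [smul_add, smul_add, hx, hy]

instance indTower : IsScalarTower K (In K n) (Ind K n N) := by
  constructor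
  intro c a v
  show toBn K n (c • a) • v = algebraMap K (Dn K n) c • ((toBn K n a : Bn K n) • v)
  rw [Algebra.smul_def, map_mul, mul_smul]
  exact ind_key K n N c _

end Ind


section BnQuot

variable (J : Submodule (Bn K n) (Bn K n))

instance : Module (In K n) (Bn K n ⧸ J) := Module.compHom _ (toBn K n)

instance : Module K (Bn K n ⧸ J) :=
  Module.compHom _ ((toBn K n).comp (algebraMap K (In K n)))

instance : IsScalarTower K (In K n) (Bn K n ⧸ J) := by
  constructor
  intro c a v
  show toBn K n (c • a) • v = (toBn K n (algebraMap K (In K n) c)) • (toBn K n a • v)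
  rw [Algebra.smul_def, map_mul, mul_smul]

end BnQuot

/-- The `𝕀_n`-module `M` "is" the tensor product `A ⊗ B` of an `𝕀_m`-module `A` and an
`𝕀_{n-m}`-module `B`: there is a `K`-linear isomorphism under which the generators of `𝕀_n`
with index `< m` act on the first factor (via the corresponding generators of `𝕀_m`) and the
remaining generators act on the second factor (via the generators of `𝕀_{n-m}`). -/
def RealizesSplit (m : ℕ) (A : Type*) [AddCommGroup A] [Module K A] [Module (In K m) A]
    [IsScalarTower K (In K m) A]
    (B : Type*) [AddCommGroup B] [Module K B] [Module (In K (n - m)) B]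
    [IsScalarTower K (In K (n - m)) B]
    (M : Type*) [AddCommGroup M] [Module K M] [Module (In K n) M]
    [IsScalarTower K (In K n) M] : Prop :=
  ∃ φ : M ≃ₗ[K] A ⊗[K] B,
    (∀ (i : Fin n) (hi : (i : ℕ) < m) (v : M),
      φ (xEl K n i • v) = LinearMap.rTensor B
        (DistribMulAction.toLinearMap K A (xEl K m ⟨i, hi⟩)) (φ v) ∧
      φ (dEl K n i • v) = LinearMap.rTensor B
        (DistribMulAction.toLinearMap K A (dEl K m ⟨i, hi⟩)) (φ v) ∧
      φ (intEl K n i • v) = LinearMap.rTensor B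
        (DistribMulAction.toLinearMap K A (intEl K m ⟨i, hi⟩)) (φ v)) ∧
    (∀ (i : Fin n) (hi : m ≤ (i : ℕ)) (v : M),
      φ (xEl K n i • v) = LinearMap.lTensor A
        (DistribMulAction.toLinearMap K B (xEl K (n - m) ⟨(i : ℕ) - m, by omega⟩)) (φ v) ∧
      φ (dEl K n i • v) = LinearMap.lTensor A
        (DistribMulAction.toLinearMap K B (dEl K (n - m) ⟨(i : ℕ) - m, by omega⟩)) (φ v) ∧
      φ (intEl K n i • v) = LinearMap.lTensor A
        (DistribMulAction.toLinearMap K B (intEl K (n - m) ⟨(i : ℕ) - m, by omega⟩)) (φ v))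

end


noncomputable section Aux1

variable (K : Type*) [Field K] [CharZero K] (n : ℕ)

lemma aux_ext {a b : In K n} (h : ∀ p : P K n, a • p = b • p) : a = b := by
  have : (show InSub K n from a) = (show InSub K n from b) :=
    Subtype.ext (LinearMap.ext fun p => h p)
  exact this

lemma aux_ind {p : In K n → Prop} (hx : ∀ i, p (xEl K n i)) (hd : ∀ i, p (dEl K n i))
    (hi : ∀ i, p (intEl K n i)) (hc : ∀ c, p (algebraMap K (In K n) c))
    (ha : ∀ a b, p a → p b → p (a + b)) (hm : ∀ a b, p a → p b → p (a * b)) (a : In K n) : p a := by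
  have key : ∀ (y : Module.End K (P K n)) (hy : y ∈ InSub K n),
      p (show InSub K n from ⟨y, hy⟩) := by
    intro y hy
    refine Algebra.adjoin_induction (R := K)
      (p := fun z hz => p (show InSub K n from ⟨z, hz⟩)) ?_ ?_ ?_ ?_ hy
    · rintro x ((⟨i, rfl⟩ | ⟨i, rfl⟩) | ⟨i, rfl⟩)
      · exact hx i
      · exact hd i
      · exact hi i
    · exact hc
    · intro x y hx hy h1 h2
      exact ha _ _ h1 h2
    · intro x y hx hy h1 h2
      exact hm _ _ h1 h2
  exact key a.1 a.2

lemma aux_algebraMap_smul (c : K) (p : P K n) : algebraMap K (In K n) c • p = c • p :=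
  algebraMap_smul _ c p

lemma aux_smul_K (a : In K n) (c : K) (p : P K n) : a • (c • p) = c • (a • p) := by
  rw [← aux_algebraMap_smul, ← aux_algebraMap_smul, ← mul_smul, ← mul_smul, Algebra.commutes]

/-- divided power monomials indexed by integer vectors -/
def eb (γ : Fin n → ℤ) : P K n :=
  open Classical in
  if ∀ i, 0 ≤ γ i then MvPolynomial.monomial (Finsupp.equivFunOnFinite.symm fun i => (γ i).toNat)
    (∏ i, ((γ i).toNat.factorial : K))⁻¹ else 0

lemma eb_nat (g : Fin n → ℕ) : eb K n (fun i => (g i : ℤ)) =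
    MvPolynomial.monomial (Finsupp.equivFunOnFinite.symm g) (∏ i, ((g i).factorial : K))⁻¹ := by
  simp [eb]

lemma eb_neg {γ : Fin n → ℤ} (i : Fin n) (h : γ i < 0) : eb K n γ = 0 := by
  rw [eb, if_neg]
  intro h'
  exact absurd (h' i) (not_le.mpr h)

lemma aux_fact_pos (g : Fin n → ℕ) : (∏ i, ((g i).factorial : K)) ≠ 0 := by
  rw [Finset.prod_ne_zero_iff]
  intro i _
  exact_mod_cast (g i).factorial_ne_zero

lemma aux_prod_fact (g : Fin n → ℕ) (i : Fin n) :
    (∏ j, (((g + Pi.single i 1 : Fin n → ℕ) j).factorial : K)) = (g i + 1) * ∏ j, ((g j).factorial : K) := by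
  have : ∀ j, (((g + Pi.single i 1 : Fin n → ℕ) j).factorial : K) =
      (if j = i then (g i + 1 : K) else 1) * ((g j).factorial : K) := by
    intro j
    by_cases h : j = i
    · subst h
      simp [Nat.factorial_succ]
    · simp [h]
  simp_rw [this, Finset.prod_mul_distrib]
  simp

lemma aux_fs (g : Fin n → ℕ) (i : Fin n) : (Finsupp.equivFunOnFinite.symm g : Fin n →₀ ℕ) + Finsupp.single i 1
    = Finsupp.equivFunOnFinite.symm (g + Pi.single i 1) := by
  ext j
  simp [Finsupp.single_apply, Pi.single_apply, eq_comm]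

lemma aux_cast_add (g : Fin n → ℕ) (i : Fin n) :
    (fun j => ((g j : ℕ) : ℤ)) + Pi.single i 1 = fun j => (((g + Pi.single i 1 : Fin n → ℕ) j : ℕ) : ℤ) := by
  ext j
  by_cases h : j = i
  · subst h; simp
  · simp [h]

lemma x_eb (i : Fin n) (γ : Fin n → ℤ) :
    xEl K n i • eb K n γ = ((γ i : K) + 1) • eb K n (γ + Pi.single i 1) := by
  by_cases h : ∀ j, 0 ≤ γ j
  · lift γ to Fin n → ℕ using h
    rw [aux_cast_add, eb_nat, eb_nat, xEl_smul, MvPolynomial.X, MvPolynomial.monomial_mul, one_mul,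
      add_comm, aux_fs, aux_prod_fact, MvPolynomial.smul_monomial]
    congr 1
    have : (γ i + 1 : K) ≠ 0 := Nat.cast_add_one_ne_zero _
    have h2 := aux_fact_pos K n γ
    simp only [smul_eq_mul, Int.cast_natCast]
    field_simp
  · push Not at h
    obtain ⟨j, hj⟩ := h
    rw [eb_neg K n j hj, smul_zero]
    by_cases hji : j = i
    · subst hji
      by_cases h1 : γ j = -1
      · simp [h1]
      · rw [eb_neg K n j, smul_zero]
        simp; omega
    · rw [eb_neg K n j, smul_zero]
      simpa [hji] using hj

lemma int_eb (i : Fin n) (γ : Fin n → ℤ) (h1 : γ i ≠ -1) :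
    intEl K n i • eb K n γ = eb K n (γ + Pi.single i 1) := by
  by_cases h : ∀ j, 0 ≤ γ j
  · lift γ to Fin n → ℕ using h
    rw [aux_cast_add, eb_nat, eb_nat]
    have : ∀ (a : Fin n →₀ ℕ) (c : K), intEl K n i • (MvPolynomial.monomial a c : P K n)
        = ((a i : K) + 1)⁻¹ • MvPolynomial.monomial (a + Finsupp.single i 1) c := by
      intro a c
      have e : (MvPolynomial.monomial a c : P K n) = c • MvPolynomial.basisMonomials (Fin n) K a := by
        simp [MvPolynomial.smul_monomial]
      rw [e, aux_smul_K]
      have : intEl K n i • MvPolynomial.basisMonomials (Fin n) K a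
        = intOp K n i (MvPolynomial.basisMonomials (Fin n) K a) := rfl
      rw [this, intOp, Module.Basis.constr_basis, smul_comm, MvPolynomial.smul_monomial]
      simp
    rw [this, aux_fs, aux_prod_fact, MvPolynomial.smul_monomial]
    congr 1
    simp [mul_comm]
  · push Not at h
    obtain ⟨j, hj⟩ := h
    rw [eb_neg K n j hj, smul_zero]
    by_cases hji : j = i
    · subst hji
      rw [eb_neg K n j]
      simp; omega
    · rw [eb_neg K n j]
      simpa [hji] using hj

lemma d_eb (i : Fin n) (γ : Fin n → ℤ) :
    dEl K n i • eb K n γ = eb K n (γ - Pi.single i 1) := by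
  by_cases h : ∀ j, 0 ≤ γ j
  · by_cases h0 : γ i = 0
    · rw [eb_neg K n (γ := γ - Pi.single i 1) i (by simp [h0])]
      lift γ to Fin n → ℕ using h
      rw [eb_nat, dEl_smul, MvPolynomial.pderiv_monomial]
      have : γ i = 0 := by simpa using h0
      simp [this]
    · have h' : ∀ j, 0 ≤ (γ - Pi.single i 1 : Fin n → ℤ) j := by
        intro j
        have := h j
        by_cases hji : j = i
        · subst hji
          simp; omega
        · simpa [hji] using this
      obtain ⟨δ, hδ⟩ : ∃ δ, δ = γ - Pi.single i 1 := ⟨_, rfl⟩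
      have hγ : γ = δ + Pi.single i 1 := by rw [hδ]; simp
      rw [← hδ] at h' ⊢
      subst hγ
      lift δ to Fin n → ℕ using h'
      rw [aux_cast_add, eb_nat, eb_nat, dEl_smul, MvPolynomial.pderiv_monomial, ← aux_fs,
        add_tsub_cancel_right, aux_prod_fact]
      congr 1
      have : (δ i + 1 : K) ≠ 0 := Nat.cast_add_one_ne_zero _
      have h2 := aux_fact_pos K n δ
      simp
      field_simp
  · push Not at h
    obtain ⟨j, hj⟩ := h
    rw [eb_neg K n j hj, smul_zero, eb_neg K n j]
    by_cases hji : j = i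
    · subst hji
      simp; omega
    · simpa [hji] using hj

lemma H_eb (i : Fin n) (γ : Fin n → ℤ) :
    HEl K n i • eb K n γ = ((γ i : K) + 1) • eb K n γ := by
  rw [HEl, mul_smul, x_eb, aux_smul_K, d_eb, add_sub_cancel_right]

lemma aux_ext_eb {a b : In K n} (h : ∀ γ : Fin n → ℤ, (∀ i, 0 ≤ γ i) → a • eb K n γ = b • eb K n γ) :
    a = b := by
  apply aux_ext
  intro p
  induction p using MvPolynomial.induction_on' with
  | monomial α c =>
      have h2 := aux_fact_pos K n α
      have := h (fun i => (α i : ℤ)) (fun i => by positivity)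
      rw [eb_nat] at this
      have e : (MvPolynomial.monomial α c : P K n) = (c * ∏ i, ((α i).factorial : K)) •
          MvPolynomial.monomial (Finsupp.equivFunOnFinite.symm ⇑α) (∏ i, ((α i).factorial : K))⁻¹ := by
        rw [MvPolynomial.smul_monomial, smul_eq_mul, mul_assoc, mul_inv_cancel₀ h2]
        simp
      rw [e, aux_smul_K, this, aux_smul_K]
  | add p q hp hq => rw [smul_add, smul_add, hp, hq]

lemma rel_d_int (i : Fin n) : dEl K n i * intEl K n i = 1 := by
  apply aux_ext_eb
  intro γ h
  rw [mul_smul, int_eb _ _ _ _ (by have := h i; omega), d_eb, add_sub_cancel_right, one_smul]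

lemma rel_int_int (i j : Fin n) : intEl K n i * intEl K n j = intEl K n j * intEl K n i := by
  apply aux_ext_eb
  intro γ h
  have hi := h i
  have hj := h j
  by_cases hij : i = j
  · rw [hij]
  · rw [mul_smul, mul_smul, int_eb _ _ _ _ (by omega), int_eb _ _ _ _ (by simp [hij]; omega),
      int_eb _ _ _ _ (by omega), int_eb _ _ _ _ (by simp [Ne.symm hij]; omega), add_right_comm]

lemma rel_H_int (i j : Fin n) : HEl K n i * intEl K n j
    = intEl K n j * (HEl K n i + algebraMap K _ (((Pi.single j 1 : Fin n → ℤ) i : ℤ) : K)) := by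
  apply aux_ext_eb
  intro γ h
  have hj := h j
  rw [mul_smul, mul_smul, add_smul, smul_add, int_eb _ _ _ _ (by omega), H_eb, H_eb, aux_smul_K,
    aux_algebraMap_smul, aux_smul_K, int_eb _ _ _ _ (by omega), ← add_smul]
  congr 1
  simp
  ring

lemma rel_x (i : Fin n) : xEl K n i = intEl K n i * HEl K n i := by
  apply aux_ext_eb
  intro γ h
  have hj := h i
  rw [mul_smul, H_eb, aux_smul_K, int_eb _ _ _ _ (by omega), x_eb]

/-- the ideal of eventually vanishing operators -/
def TT : TwoSidedIdeal (In K n) :=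
  TwoSidedIdeal.mk' {a | ∃ N : ℤ, ∀ γ : Fin n → ℤ, (∀ i, N ≤ γ i) → a • eb K n γ = 0}
    ⟨0, fun γ _ => zero_smul _ _⟩
    (by
      rintro a b ⟨N, hN⟩ ⟨N', hN'⟩
      refine ⟨max N N', fun γ h => ?_⟩
      rw [add_smul, hN γ (fun i => le_trans (le_max_left _ _) (h i)),
        hN' γ (fun i => le_trans (le_max_right _ _) (h i)), add_zero])
    (by
      rintro a ⟨N, hN⟩
      exact ⟨N, fun γ h => by rw [neg_smul, hN γ h, neg_zero]⟩)
    (by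
      rintro a b ⟨N, hN⟩
      exact ⟨N, fun γ h => by rw [mul_smul, hN γ h, smul_zero]⟩)
    (by
      rintro a b ⟨N, hN⟩
      have key : ∀ r : In K n, ∃ M : ℕ, ∀ γ : Fin n → ℤ,
          r • eb K n γ ∈ Submodule.span K (eb K n '' {δ | ∀ i, γ i - M ≤ δ i}) := by
        intro r
        induction r using aux_ind with
        | hx i =>
          refine ⟨0, fun γ => ?_⟩
          rw [x_eb]
          refine Submodule.smul_mem _ _ (Submodule.subset_span ⟨_, ?_, rfl⟩)
          intro j
          by_cases hji : j = i
          · subst hji; simp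
          · simp [hji]
        | hd i =>
          refine ⟨1, fun γ => ?_⟩
          rw [d_eb]
          refine (Submodule.subset_span ⟨_, ?_, rfl⟩)
          intro j
          by_cases hji : j = i
          · subst hji; simp
          · simp [hji]
        | hi i =>
          refine ⟨0, fun γ => ?_⟩
          by_cases h1 : γ i = -1
          · rw [eb_neg K n i (by omega), smul_zero]
            exact zero_mem _
          rw [int_eb _ _ _ _ h1]
          refine (Submodule.subset_span ⟨_, ?_, rfl⟩)
          intro j
          by_cases hji : j = i
          · subst hji; simp
          · simp [hji]
        | hc c =>
          refine ⟨0, fun γ => ?_⟩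
          rw [aux_algebraMap_smul]
          exact Submodule.smul_mem _ _ (Submodule.subset_span ⟨_, by simp, rfl⟩)
        | ha a b h1 h2 =>
          obtain ⟨M, hM⟩ := h1
          obtain ⟨M', hM'⟩ := h2
          refine ⟨M + M', fun γ => ?_⟩
          rw [add_smul]
          refine add_mem (Submodule.span_mono (Set.image_mono ?_) (hM γ))
            (Submodule.span_mono (Set.image_mono ?_) (hM' γ))
          · intro δ h i
            have := h i
            push_cast; omega
          · intro δ h i
            have := h i
            push_cast; omega
        | hm a b h1 h2 =>
          obtain ⟨M, hM⟩ := h1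
          obtain ⟨M', hM'⟩ := h2
          refine ⟨M + M', fun γ => ?_⟩
          rw [mul_smul]
          have := hM' γ
          generalize b • eb K n γ = w at this ⊢
          induction this using Submodule.span_induction with
          | mem x hx =>
            obtain ⟨δ, hδ, rfl⟩ := hx
            refine (Submodule.span_mono (Set.image_mono ?_) (hM δ))
            intro ε h i
            have h1 := h i
            have h2 := hδ i
            push_cast; omega
          | zero => rw [smul_zero]; exact zero_mem _
          | add x y _ _ hx hy => rw [smul_add]; exact add_mem hx hy
          | smul c x _ hx => rw [aux_smul_K]; exact Submodule.smul_mem _ _ hx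
      obtain ⟨M, hM⟩ := key b
      refine ⟨N + M, fun γ h => ?_⟩
      rw [mul_smul]
      have := hM γ
      generalize b • eb K n γ = w at this ⊢
      induction this using Submodule.span_induction with
      | mem x hx =>
        obtain ⟨δ, hδ, rfl⟩ := hx
        refine hN _ (fun i => ?_)
        have h1 := h i
        have h2 := hδ i
        omega
      | zero => rw [smul_zero]
      | add x y _ _ hx hy => rw [smul_add, hx, hy, add_zero]
      | smul c x _ hx => rw [aux_smul_K, hx, smul_zero])

lemma mem_TT {a : In K n} : a ∈ TT K n ↔
    ∃ N : ℤ, ∀ γ : Fin n → ℤ, (∀ i, N ≤ γ i) → a • eb K n γ = 0 := by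
  rw [TT, TwoSidedIdeal.mem_mk']
  rfl

lemma d_pow_eb (i : Fin n) (t : ℕ) (γ : Fin n → ℤ) :
    dEl K n i ^ t • eb K n γ = eb K n (γ - Pi.single i (t : ℤ)) := by
  induction t with
  | zero => simp
  | succ t ih =>
    rw [pow_succ', mul_smul, ih, d_eb]
    congr 1
    rw [sub_sub, ← Pi.single_add]
    simp

lemma int_pow_eb (i : Fin n) (t : ℕ) (γ : Fin n → ℤ) (h : 0 ≤ γ i) :
    intEl K n i ^ t • eb K n γ = eb K n (γ + Pi.single i (t : ℤ)) := by
  induction t with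
  | zero => simp
  | succ t ih =>
    rw [pow_succ', mul_smul, ih, int_eb]
    · congr 1
      rw [add_assoc, ← Pi.single_add]
      simp
    · simp; omega

lemma aFull_le_TT : aFull K n ≤ TT K n := by
  rw [aFull, aIdeal]
  refine iSup₂_le fun i _ => ?_
  rw [pIdeal, TwoSidedIdeal.span_le]
  rintro a ⟨s, t, rfl⟩
  rw [SetLike.mem_coe, mem_TT]
  refine ⟨t + 1, fun γ h => ?_⟩
  have := h i
  rw [eElN, sub_smul, mul_smul, mul_smul, d_pow_eb, d_pow_eb, int_pow_eb, int_pow_eb, sub_eq_zero]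
  · congr 1
    rw [sub_add, sub_add, ← Pi.single_sub, ← Pi.single_sub]
    simp
  · simp; omega
  · simp; omega

lemma toBn_eq_zero {a : In K n} : toBn K n a = 0 ↔ a ∈ aFull K n := by
  rw [TwoSidedIdeal.mem_iff, ← RingCon.eq]
  rfl

lemma bn_int_d (i : Fin n) : toBn K n (intEl K n i) * toBn K n (dEl K n i) = 1 := by
  have h : eElN K n i 0 0 ∈ aFull K n := by
    have h1 : pIdeal K n i ≤ aFull K n :=
      le_iSup₂_of_le (f := fun i (_ : i ∈ Set.univ) => pIdeal K n i) i (Set.mem_univ i) le_rfl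
    exact h1 (TwoSidedIdeal.subset_span ⟨0, 0, rfl⟩)
  rw [← toBn_eq_zero] at h
  simp [eElN, sub_eq_zero] at h
  exact h.symm

lemma bn_d_int (i : Fin n) : toBn K n (dEl K n i) * toBn K n (intEl K n i) = 1 := by
  rw [← map_mul, rel_d_int, map_one]

end Aux1
noncomputable section Aux2

variable (K : Type*) [Field K] [CharZero K] (n : ℕ)

lemma aux_zind {p : (Fin n → ℤ) → Prop} (h0 : p 0) (hadd : ∀ a b, p a → p b → p (a + b))
    (h1 : ∀ i, p (Pi.single i 1)) (hm : ∀ i, p (Pi.single i (-1))) (α : Fin n → ℤ) : p α := by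
  have hs : ∀ i (z : ℤ), p (Pi.single i z) := by
    intro i z
    induction z using Int.induction_on with
    | zero => simpa using h0
    | succ k ih => rw [Pi.single_add]; exact hadd _ _ ih (h1 i)
    | pred k ih => rw [sub_eq_add_neg, Pi.single_add]; exact hadd _ _ ih (hm i)
  rw [← Finset.univ_sum_single α]
  exact Finset.sum_induction _ p hadd h0 (fun i _ => hs i _)

/-- the unit `∫_i` of `B_n` -/
def du (i : Fin n) : (Bn K n)ˣ :=
  ⟨toBn K n (intEl K n i), toBn K n (dEl K n i), bn_int_d K n i, bn_d_int K n i⟩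

lemma du_comm (i j : Fin n) : Commute (du K n i) (du K n j) := by
  apply Units.ext
  show toBn K n (intEl K n i) * toBn K n (intEl K n j) = toBn K n (intEl K n j) * toBn K n (intEl K n i)
  rw [← map_mul, ← map_mul, rel_int_int]

/-- the units `∫^α` of `B_n`. -/
def uuHom : (Fin n → Multiplicative ℤ) →* (Bn K n)ˣ :=
  MonoidHom.noncommPiCoprod (fun i => zpowersHom _ (du K n i)) (by
    intro i j _ x y
    rw [zpowersHom_apply, zpowersHom_apply]
    exact Commute.zpow_zpow (du_comm K n i j) _ _)

/-- the units `∫^α` of `B_n`. -/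
def uu (α : Fin n → ℤ) : (Bn K n)ˣ := uuHom K n (fun i => Multiplicative.ofAdd (α i))

lemma uu_add (α β : Fin n → ℤ) : uu K n (α + β) = uu K n α * uu K n β := by
  rw [uu, uu, uu, ← map_mul]
  rfl

lemma uu_zero : uu K n 0 = 1 := map_one (uuHom K n)

lemma uu_single (i : Fin n) (z : ℤ) : uu K n (Pi.single i z) = du K n i ^ z := by
  have : (fun j => Multiplicative.ofAdd ((Pi.single i z : Fin n → ℤ) j)) =
      Pi.mulSingle i (Multiplicative.ofAdd z) := by
    ext j
    by_cases h : j = i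
    · subst h; simp
    · simp [h]
  rw [uu, this, uuHom]
  exact (MonoidHom.noncommPiCoprod_mulSingle _ _ _).trans rfl

lemma bnD_H (i : Fin n) : bnD K n (HElD K n i) = toBn K n (HEl K n i) := rfl

lemma bnD_c (c : K) : bnD K n (algebraMap K _ c) = toBn K n (algebraMap K _ c) := by
  rw [bnD, RingHom.comp_apply, dnVal_algebraMap]

lemma bnD_c_comm (c : K) (b : Bn K n) : bnD K n (algebraMap K _ c) * b = b * bnD K n (algebraMap K _ c) := by
  rw [bnD_c, bn_algebraMap_comm]

lemma H_uu (i : Fin n) (α : Fin n → ℤ) : bnD K n (HElD K n i) * uu K n α =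
    uu K n α * bnD K n (HElD K n i + algebraMap K _ (α i : K)) := by
  have h1 : ∀ j, bnD K n (HElD K n i) * du K n j =
      du K n j * bnD K n (HElD K n i + algebraMap K _ (((Pi.single j 1 : Fin n → ℤ) i : ℤ) : K)) := by
    intro j
    have := congrArg (toBn K n) (rel_H_int K n i j)
    rw [map_mul, map_mul, map_add] at this
    rw [map_add, bnD_c]
    exact this
  induction α using aux_zind with
  | h0 => simp [uu_zero]
  | hadd a b ha hb =>
    rw [uu_add, Units.val_mul, ← mul_assoc, ha, mul_assoc, map_add, add_mul, hb, bnD_c_comm,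
      ← mul_add, mul_assoc, ← map_add]
    congr 3
    rw [add_assoc, ← map_add, Pi.add_apply]
    congr 2
    push_cast
    ring
  | h1 j => rw [uu_single, zpow_one]; exact h1 j
  | hm j =>
    rw [uu_single, zpow_neg, zpow_one, Units.mul_inv_eq_iff_eq_mul, mul_assoc]
    rw [Units.eq_inv_mul_iff_mul_eq, map_add, add_mul, h1, map_add, mul_add, bnD_c_comm, add_assoc,
      ← mul_add, ← map_add, ← map_add]
    simp [Pi.single_neg]

/-- the polynomial presentation of `D_n`. -/
def piD : MvPolynomial (Fin n) K →ₐ[K] Dn K n := MvPolynomial.aeval (HElD K n)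

lemma piD_surj : Function.Surjective (piD K n) := by
  have key : ∀ (y : In K n) (hy : y ∈ DnSub K n),
      ∃ p, piD K n p = (show DnSub K n from ⟨y, hy⟩) := by
    intro y hy
    refine Algebra.adjoin_induction (R := K)
      (p := fun z hz => ∃ p, piD K n p = (show DnSub K n from ⟨z, hz⟩)) ?_ ?_ ?_ ?_ hy
    · rintro x ⟨i, rfl⟩
      exact ⟨MvPolynomial.X i, MvPolynomial.aeval_X _ _⟩
    · intro c
      exact ⟨MvPolynomial.C c, MvPolynomial.aeval_C _ _⟩
    · rintro x y hx hy ⟨p, hp⟩ ⟨q, hq⟩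
      exact ⟨p + q, by rw [map_add, hp, hq]; rfl⟩
    · rintro x y hx hy ⟨p, hp⟩ ⟨q, hq⟩
      exact ⟨p * q, by rw [map_mul, hp, hq]; rfl⟩
  intro d
  exact key d.1 d.2

lemma piD_eb (p : MvPolynomial (Fin n) K) (γ : Fin n → ℤ) :
    dnVal K n (piD K n p) • eb K n γ = MvPolynomial.eval (fun i => (γ i : K) + 1) p • eb K n γ := by
  induction p using MvPolynomial.induction_on with
  | C c =>
    rw [piD, MvPolynomial.aeval_C, dnVal_algebraMap, aux_algebraMap_smul, MvPolynomial.eval_C]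
  | add p q hp hq => rw [map_add, map_add, add_smul, hp, hq, map_add, add_smul]
  | mul_X p i hp =>
    rw [map_mul, map_mul, mul_smul, map_mul, MvPolynomial.eval_X]
    have : dnVal K n (piD K n (MvPolynomial.X i)) = HEl K n i := by
      rw [piD, MvPolynomial.aeval_X]; rfl
    rw [this, H_eb, aux_smul_K, hp, smul_smul, mul_comm]

lemma eb_ne_zero (γ : Fin n → ℤ) (h : ∀ i, 0 ≤ γ i) : eb K n γ ≠ 0 := by
  lift γ to Fin n → ℕ using h
  rw [eb_nat, Ne, MvPolynomial.monomial_eq_zero]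
  exact inv_ne_zero (aux_fact_pos K n γ)

/-- independence of the divided powers -/
lemma eb_indep (s : Finset (Fin n → ℤ)) (c : (Fin n → ℤ) → K) (hs : ∀ γ ∈ s, ∀ i, 0 ≤ γ i)
    (h : ∑ γ ∈ s, c γ • eb K n γ = 0) : ∀ γ ∈ s, c γ = 0 := by
  intro γ hγ
  have h1 := congrArg (MvPolynomial.coeff (Finsupp.equivFunOnFinite.symm fun i => (γ i).toNat)) h
  rw [MvPolynomial.coeff_sum, Finset.sum_eq_single γ] at h1
  · rw [MvPolynomial.coeff_smul, eb, if_pos (hs γ hγ), MvPolynomial.coeff_monomial, if_pos rfl] at h1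
    simp only [smul_eq_mul, MvPolynomial.coeff_zero, mul_eq_zero, inv_eq_zero] at h1
    exact h1.resolve_right (aux_fact_pos K n _)
  · intro β hβ hne
    rw [MvPolynomial.coeff_smul, eb, if_pos (hs β hβ), MvPolynomial.coeff_monomial, if_neg, smul_zero]
    intro he
    apply hne
    funext i
    have := DFunLike.congr_fun he i
    simp at this
    have h1 := hs β hβ i
    have h2 := hs γ hγ i
    omega
  · exact fun h => absurd hγ h

lemma poly_zero_of_large (p : MvPolynomial (Fin n) K) (N : ℤ)
    (h : ∀ γ : Fin n → ℤ, (∀ i, N ≤ γ i) → MvPolynomial.eval (fun i => (γ i : K) + 1) p = 0) : p = 0 := by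
  apply MvPolynomial.funext_set (fun _ => (fun z : ℤ => (z : K) + 1) '' Set.Ici N)
  · intro i
    refine (Set.Ici_infinite N).image ?_
    intro a _ b _ hab
    simpa using hab
  · intro x hx
    choose γ h1 h2 using fun i => hx i (Set.mem_univ i)
    rw [map_zero, ← h γ h1]
    congr 2
    funext i
    exact (h2 i).symm

lemma piD_inj : Function.Injective (piD K n) := by
  rw [injective_iff_map_eq_zero]
  intro p hp
  apply poly_zero_of_large K n p 0
  intro γ h
  have := piD_eb K n p γ
  rw [hp, map_zero, zero_smul] at this
  exact (smul_eq_zero.mp this.symm).resolve_right (eb_ne_zero K n γ h)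

lemma uu_lift (α : Fin n → ℤ) : ∃ a : In K n, toBn K n a = uu K n α ∧
    ∃ N : ℤ, ∀ γ : Fin n → ℤ, (∀ i, N ≤ γ i) → a • eb K n γ = eb K n (γ + α) := by
  induction α using aux_zind with
  | h0 => exact ⟨1, by simp [uu_zero], 0, fun γ _ => by simp⟩
  | hadd α β ha hb =>
    obtain ⟨a, ha, N, hN⟩ := ha
    obtain ⟨b, hb, M, hM⟩ := hb
    obtain ⟨C, hC⟩ : ∃ C : ℤ, ∀ i, -C ≤ β i :=
      ⟨∑ i, |β i|, fun i => by
        have h1 := Finset.single_le_sum (f := fun i => |β i|) (fun j _ => abs_nonneg _) (Finset.mem_univ i)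
        have h2 := neg_abs_le (β i)
        linarith⟩
    refine ⟨a * b, by rw [map_mul, ha, hb, uu_add, Units.val_mul], max M (N + C), fun γ h => ?_⟩
    rw [mul_smul, hM γ (fun i => le_trans (le_max_left _ _) (h i)), hN]
    · rw [add_right_comm, add_assoc]
    · intro i
      have h1 := hC i
      have h2 := le_trans (le_max_right _ _) (h i)
      rw [Pi.add_apply]
      omega
  | h1 i =>
    refine ⟨intEl K n i, by rw [uu_single, zpow_one]; rfl, 0, fun γ h => ?_⟩
    rw [int_eb _ _ _ _ (by have := h i; omega)]
  | hm i =>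
    refine ⟨dEl K n i, by rw [uu_single, zpow_neg, zpow_one]; rfl, 0, fun γ h => ?_⟩
    rw [d_eb, Pi.single_neg, sub_eq_add_neg]

lemma bn_smul_def (d : Dn K n) (b : Bn K n) : d • b = b * bnD K n d := rfl

lemma uu_indep : LinearIndependent (Dn K n) (fun α => (uu K n α : Bn K n)) := by
  rw [linearIndependent_iff']
  intro s g hg α hα
  choose a ha N hN using uu_lift K n
  choose p hp using fun α => piD_surj K n (g α)
  have h0 : toBn K n (∑ β ∈ s, a β * dnVal K n (g β)) = 0 := by
    rw [map_sum, ← hg]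
    refine Finset.sum_congr rfl fun β _ => ?_
    rw [map_mul, ha, bn_smul_def]
    rfl
  rw [toBn_eq_zero] at h0
  obtain ⟨M, hM⟩ := (mem_TT K n).mp (aFull_le_TT K n h0)
  rw [← hp α]
  suffices p α = 0 by rw [this, map_zero]
  apply poly_zero_of_large K n _ (|M| + ∑ β ∈ s, (|N β| + ∑ i, |β i|))
  intro γ hγ
  have hb : ∀ β ∈ s, |N β| + ∑ i, |β i| ≤ ∑ β ∈ s, (|N β| + ∑ i, |β i|) := fun β hβ =>
    Finset.single_le_sum (f := fun β => |N β| + ∑ i, |β i|)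
      (fun j _ => add_nonneg (abs_nonneg _) (Finset.sum_nonneg fun i _ => abs_nonneg _)) hβ
  have hn : 0 ≤ ∑ β ∈ s, (|N β| + ∑ i, |β i|) :=
    Finset.sum_nonneg (fun j _ => add_nonneg (abs_nonneg _) (Finset.sum_nonneg fun i _ => abs_nonneg _))
  have h1 := hM γ (fun i => le_trans (by have := le_abs_self M; linarith) (hγ i))
  rw [Finset.sum_smul] at h1
  have h2 : ∑ β ∈ s, (MvPolynomial.eval (fun i => (γ i : K) + 1) (p β)) • eb K n (γ + β) = 0 := by
    rw [← h1]
    refine Finset.sum_congr rfl fun β hβ => ?_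
    rw [mul_smul, ← hp, piD_eb, aux_smul_K, hN]
    intro i
    have := hb β hβ
    have := le_abs_self (N β)
    have := abs_nonneg M
    have : 0 ≤ ∑ i, |β i| := Finset.sum_nonneg fun i _ => abs_nonneg _
    linarith [hγ i]
  have h3 : ∑ δ ∈ s.image (γ + ·),
      (MvPolynomial.eval (fun i => (γ i : K) + 1) (p (δ - γ))) • eb K n δ = 0 := by
    rw [Finset.sum_image (by intro x _ y _ hxy; simpa using hxy), ← h2]
    refine Finset.sum_congr rfl fun β hβ => ?_
    rw [add_sub_cancel_left]
  have := eb_indep K n _ _ ?_ h3 (γ + α) (Finset.mem_image_of_mem _ hα)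
  · rwa [add_sub_cancel_left] at this
  · intro δ hδ i
    obtain ⟨β, hβ, rfl⟩ := Finset.mem_image.mp hδ
    have := hb β hβ
    have := abs_nonneg (N β)
    have := abs_nonneg M
    have := Finset.single_le_sum (f := fun i => |β i|) (fun j _ => abs_nonneg _) (Finset.mem_univ i)
    have := neg_abs_le (β i)
    simp only [Pi.add_apply] at *
    linarith [hγ i]

lemma uu_span : ⊤ ≤ Submodule.span (Dn K n) (Set.range fun α => (uu K n α : Bn K n)) := by
  have hH : ∀ i α, toBn K n (HEl K n i) * uu K n α ∈
      Submodule.span (Dn K n) (Set.range fun α => (uu K n α : Bn K n)) := by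
    intro i α
    rw [← bnD_H, H_uu]
    exact Submodule.smul_mem _ _ (Submodule.subset_span ⟨α, rfl⟩)
  have key : ∀ (a : In K n), ∀ b ∈ Submodule.span (Dn K n) (Set.range fun α => (uu K n α : Bn K n)),
      toBn K n a * b ∈ Submodule.span (Dn K n) (Set.range fun α => (uu K n α : Bn K n)) := by
    have red : ∀ r : Bn K n, (∀ α, r * uu K n α ∈
      Submodule.span (Dn K n) (Set.range fun α => (uu K n α : Bn K n))) →
      ∀ b ∈ Submodule.span (Dn K n) (Set.range fun α => (uu K n α : Bn K n)),
      r * b ∈ Submodule.span (Dn K n) (Set.range fun α => (uu K n α : Bn K n)) := by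
      intro r hr b hb
      induction hb using Submodule.span_induction with
      | mem x hx => obtain ⟨α, rfl⟩ := hx; exact hr α
      | zero => rw [mul_zero]; exact zero_mem _
      | add x y _ _ hx hy => rw [mul_add]; exact add_mem hx hy
      | smul d x _ hx =>
        rw [bn_smul_def, ← mul_assoc]
        exact Submodule.smul_mem _ _ hx
    have hint : ∀ i, ∀ b ∈ Submodule.span (Dn K n) (Set.range fun α => (uu K n α : Bn K n)),
      toBn K n (intEl K n i) * b ∈ Submodule.span (Dn K n) (Set.range fun α => (uu K n α : Bn K n)) := by
      intro i
      apply red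
      intro α
      refine Submodule.subset_span ⟨Pi.single i 1 + α, ?_⟩
      simp only [uu_add, uu_single, zpow_one, Units.val_mul]
      rfl
    intro a
    induction a using aux_ind with
    | hi i => exact hint i
    | hx i =>
      intro b hb
      rw [rel_x, map_mul, mul_assoc]
      exact hint i _ (red _ (hH i) b hb)
    | hd i =>
      apply red
      intro α
      refine Submodule.subset_span ⟨Pi.single i (-1) + α, ?_⟩
      simp only [uu_add, uu_single, zpow_neg, zpow_one, Units.val_mul]
      rfl
    | hc c =>
      intro b hb
      rw [← bnD_c, bnD_c_comm]
      exact Submodule.smul_mem _ _ hb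
    | ha a b h1 h2 =>
      intro x hx
      rw [map_add, add_mul]
      exact add_mem (h1 x hx) (h2 x hx)
    | hm a b h1 h2 =>
      intro x hx
      rw [map_mul, mul_assoc]
      exact h1 _ (h2 x hx)
  intro b _
  obtain ⟨a, rfl⟩ := toBn_surjective K n b
  have := key a 1 (Submodule.subset_span ⟨0, by simp [uu_zero]⟩)
  rwa [mul_one] at this

/-- basis of `B_n` as a right `D_n`-module -/
def bB : Module.Basis (Fin n → ℤ) (Dn K n) (Bn K n) := Module.Basis.mk (uu_indep K n) (uu_span K n)

lemma bB_apply (α : Fin n → ℤ) : bB K n α = uu K n α := Module.Basis.mk_apply _ _ _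

lemma p_uu (p : MvPolynomial (Fin n) K) (α : Fin n → ℤ) : bnD K n (piD K n p) * uu K n α =
    uu K n α * bnD K n (MvPolynomial.aeval (fun i => HElD K n i + algebraMap K _ (α i : K)) p) := by
  induction p using MvPolynomial.induction_on with
  | C c =>
    rw [piD, MvPolynomial.aeval_C, MvPolynomial.aeval_C, bnD_c_comm]
  | add p q hp hq => rw [map_add, map_add, add_mul, hp, hq, map_add, map_add, mul_add]
  | mul_X p i hp =>
    rw [map_mul, map_mul, mul_assoc, map_mul, map_mul, MvPolynomial.aeval_X]
    have : (piD K n (MvPolynomial.X i)) = HElD K n i := by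
      rw [piD, MvPolynomial.aeval_X]
    rw [this, H_uu, ← mul_assoc, hp, mul_assoc]

/-- evaluation on `D_n` -/
def evD (mu : Fin n → K) : Dn K n →ₐ[K] K :=
  (MvPolynomial.aeval mu).comp (AlgEquiv.ofBijective (piD K n) ⟨piD_inj K n, piD_surj K n⟩).symm.toAlgHom

lemma evD_piD (mu : Fin n → K) (p) : evD K n mu (piD K n p) = MvPolynomial.eval mu p := by
  have : (AlgEquiv.ofBijective (piD K n) ⟨piD_inj K n, piD_surj K n⟩).symm (piD K n p) = p :=
    (AlgEquiv.ofBijective (piD K n) ⟨piD_inj K n, piD_surj K n⟩).symm_apply_apply p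
  simp only [evD, AlgHom.comp_apply]
  erw [this]
  rfl

lemma evD_H (mu : Fin n → K) (i) : evD K n mu (HElD K n i) = mu i := by
  have := evD_piD K n mu (MvPolynomial.X i)
  rwa [piD, MvPolynomial.aeval_X, MvPolynomial.eval_X] at this

lemma mIdeal_evD (mu : Fin n → K) (d : Dn K n) (hd : d ∈ mIdeal K n mu) : evD K n mu d = 0 := by
  have : mIdeal K n mu ≤ RingHom.ker (evD K n mu) := by
    rw [mIdeal, Ideal.span_le]
    rintro x ⟨i, rfl⟩
    rw [SetLike.mem_coe, RingHom.mem_ker, map_sub, evD_H, AlgHom.commutes]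
    simp
  exact this hd

end Aux2
noncomputable section Aux3

variable {K : Type*} [Field K] [CharZero K] {n : ℕ}
variable {M : Type*} [AddCommGroup M] [Module K M] [Module (In K n) M] [IsScalarTower K (In K n) M]
variable {N : Type*} [AddCommGroup N] [Module K N] [Module (Dn K n) N] [IsScalarTower K (Dn K n) N]

/-- `M` is a graded model of the module induced from `N` -/
structure Good (φ : M ≃ₗ[K] ((Fin n → ℤ) →₀ N)) (lam : Fin n → K) (k : ℕ) : Prop where
  hH : ∀ i v α, φ (HEl K n i • v) α = (HElD K n i + algebraMap K _ (α i : K)) • φ v α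
  hI : ∀ i v α, φ (intEl K n i • v) α = φ v (α - Pi.single i 1)
  hD : ∀ i v α, φ (dEl K n i • v) α = φ v (α + Pi.single i 1)
  hnil : ∀ i (x : N), (HElD K n i - algebraMap K _ (lam i)) ^ k • x = 0

lemma dn_mul_smul (a b : Dn K n) (x : N) : (a * b) • x = a • b • x := by
  letI : MulAction (Dn K n) N := Module.toDistribMulAction.toMulAction
  exact MulAction.toSemigroupAction.mul_smul a b x

lemma aux_cancel {i : Fin n} {l : K} {k : ℕ}
    (hnil : ∀ (x : N), (HElD K n i - algebraMap K _ l) ^ k • x = 0)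
    (J : Submodule (Dn K n) N) (c : K) (hc : c ≠ l) (m : ℕ) (x : N)
    (h : (HElD K n i - algebraMap K _ c) ^ m • x ∈ J) : x ∈ J := by
  induction m with
  | zero => simpa using h
  | succ m ih =>
    apply ih
    rw [pow_succ', dn_mul_smul] at h
    generalize (HElD K n i - algebraMap K _ c) ^ m • x = y at h
    obtain ⟨q, hq⟩ := sub_dvd_pow_sub_pow (HElD K n i - algebraMap K _ l) (algebraMap K _ (c - l)) k
    have e : HElD K n i - algebraMap K (Dn K n) l - algebraMap K (Dn K n) (c - l)
      = HElD K n i - algebraMap K _ c := by rw [map_sub]; ring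
    have h1 : -((algebraMap K (Dn K n) (c - l)) ^ k • y) ∈ J := by
      have : ((HElD K n i - algebraMap K (Dn K n) l) ^ k - (algebraMap K (Dn K n) (c - l)) ^ k) • y
          = q • ((HElD K n i - algebraMap K _ c) • y) := by
        rw [hq, e, mul_comm, dn_mul_smul]
      rw [sub_smul, hnil, zero_sub] at this
      rw [this]
      exact J.smul_mem _ h
    have h2 := J.smul_mem (algebraMap K (Dn K n) ((c - l) ^ k)⁻¹) (neg_mem h1)
    rwa [neg_neg, ← map_pow, smul_smul, ← map_mul, inv_mul_cancel₀ (pow_ne_zero _ (sub_ne_zero.mpr hc)),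
      map_one, one_smul] at h2

lemma orbit_form {K : Type*} [Field K] [CharZero K] {n : ℕ} {lam : Fin n → K} {mu : Fin n → K} (h : mu ∈ orbitOf K n lam) :
    ∃ β : Fin n → ℤ, mu = fun i => lam i + β i := by
  choose β hβ using h
  exact ⟨β, funext fun i => by rw [← hβ i]; ring⟩

namespace Good

variable {φ : M ≃ₗ[K] ((Fin n → ℤ) →₀ N)} {lam : Fin n → K} {k : ℕ} (G : Good φ lam k)

include G

lemma pow_apply (i : Fin n) (c : K) (m : ℕ) (v : M) (α : Fin n → ℤ) :
    φ ((HEl K n i - algebraMap K _ c) ^ m • v) α =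
      (HElD K n i - algebraMap K _ (c - α i)) ^ m • φ v α := by
  induction m generalizing v with
  | zero => simp
  | succ m ih =>
    rw [pow_succ, mul_smul, ih, pow_succ, dn_mul_smul, sub_smul, map_sub φ, Finsupp.sub_apply, G.hH,
      algebraMap_smul, map_smul, Finsupp.smul_apply, ← algebraMap_smul (Dn K n) c, ← sub_smul, map_sub]
    congr 2
    ring

lemma mem_gws (mu : Fin n → K) (v : M) : v ∈ genWeightSpace K n M mu ↔
    ∀ α : Fin n → ℤ, (∃ i, mu i ≠ lam i + α i) → φ v α = 0 := by
  constructor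
  · rintro ⟨m, hm⟩ α ⟨i, hi⟩
    have h := congrArg (fun w => φ w α) (hm i)
    simp only [G.pow_apply, map_zero, Finsupp.zero_apply] at h
    have := aux_cancel (G.hnil i) ⊥ (mu i - α i) (by
      intro h; apply hi; rw [← h]; ring) m (φ v α) (by rw [h]; exact zero_mem _)
    simpa using this
  · intro h
    refine ⟨k, fun i => φ.injective (Finsupp.ext fun α => ?_)⟩
    rw [G.pow_apply, map_zero, Finsupp.zero_apply]
    by_cases hα : ∃ i, mu i ≠ lam i + α i
    · rw [h α hα, smul_zero]
    · push Not at hα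
      rw [hα i, add_sub_cancel_right, G.hnil]

lemma mem_gws' (β : Fin n → ℤ) (v : M) : v ∈ genWeightSpace K n M (fun i => lam i + β i) ↔
    ∀ α, α ≠ β → φ v α = 0 := by
  rw [G.mem_gws]
  refine forall_congr' fun α => ?_
  rw [Function.ne_iff]
  simp [eq_comm]

lemma gws_bot (mu : Fin n → K) (h : mu ∉ orbitOf K n lam) : genWeightSpace K n M mu = ⊥ := by
  rw [eq_bot_iff]
  intro v hv
  rw [G.mem_gws] at hv
  rw [Submodule.mem_bot]
  apply φ.injective
  rw [map_zero]
  ext α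
  refine hv α ?_
  by_contra! h'
  exact h fun i => ⟨α i, by rw [h' i]; ring⟩

lemma isGW : IsGenWeightModule K n M := by
  letI := Classical.decEq (Fin n → K)
  show DirectSum.IsInternal (fun lam : Fin n → K => genWeightSpace K n M lam)
  refine (@DirectSum.isInternal_submodule_iff_iSupIndep_and_iSup_eq_top K _ _ (Classical.decEq (Fin n → K)) M _ _ _).mpr ⟨?_, ?_⟩
  · intro mu
    by_cases hmu : mu ∈ orbitOf K n lam
    · obtain ⟨β, rfl⟩ := orbit_form hmu
      rw [Submodule.disjoint_def]
      intro v h1 h2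
      have h3 : (⨆ j, ⨆ (_ : j ≠ fun i => lam i + β i), genWeightSpace K n M j) ≤
          LinearMap.ker ((Finsupp.lapply β).comp φ.toLinearMap : M →ₗ[K] N) := by
        refine iSup₂_le fun j hj v hv => ?_
        rw [LinearMap.mem_ker]
        rw [G.mem_gws] at hv
        exact hv β (Function.ne_iff.mp hj)
      have h4 : φ v β = 0 := h3 h2
      apply φ.injective
      rw [map_zero]
      ext α
      by_cases hα : α = β
      · rw [hα, h4]; rfl
      · exact (G.mem_gws' β v).mp h1 α hα
    · show Disjoint (genWeightSpace K n M mu) _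
      rw [G.gws_bot mu hmu]
      exact disjoint_bot_left
  · rw [eq_top_iff]
    intro v _
    obtain ⟨f, rfl⟩ := φ.symm.surjective v
    induction f using Finsupp.induction_linear with
    | zero => rw [map_zero]; exact zero_mem _
    | add f g hf hg => rw [map_add]; exact add_mem (hf trivial) (hg trivial)
    | single β x =>
      refine Submodule.mem_iSup_of_mem (fun i => lam i + β i) ?_
      rw [G.mem_gws']
      intro α hα
      rw [LinearEquiv.apply_symm_apply, Finsupp.single_eq_of_ne hα]

/-- weight spaces are copies of `N` -/
def gwsEquiv (β : Fin n → ℤ) : genWeightSpace K n M (fun i => lam i + β i) ≃ₗ[K] N where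
  toFun v := φ v β
  map_add' u v := by simp
  map_smul' c v := by simp
  invFun x := ⟨φ.symm (Finsupp.single β x), by
    rw [G.mem_gws']
    intro α hα
    rw [LinearEquiv.apply_symm_apply, Finsupp.single_eq_of_ne hα]⟩
  left_inv v := by
    apply Subtype.ext
    apply φ.injective
    rw [LinearEquiv.apply_symm_apply]
    ext α
    by_cases hα : α = β
    · rw [hα, Finsupp.single_eq_same]
    · rw [Finsupp.single_eq_of_ne hα, (G.mem_gws' β v).mp v.2 α hα]
  right_inv x := by simp

lemma supp_eq [Nontrivial N] : supp K n M = orbitOf K n lam := by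
  ext mu
  constructor
  · intro h
    by_contra h'
    exact h (G.gws_bot mu h')
  · intro h
    obtain ⟨β, rfl⟩ := orbit_form h
    have := (G.gwsEquiv β).toEquiv.nontrivial
    exact Submodule.nontrivial_iff_ne_bot.mp this

lemma finrank_eq (mu) (h : mu ∈ orbitOf K n lam) :
    Module.finrank K (genWeightSpace K n M mu) = Module.finrank K N := by
  obtain ⟨β, rfl⟩ := orbit_form h
  exact (G.gwsEquiv β).finrank_eq

lemma shift (β : Fin n → ℤ) : ∃ b : In K n, ∀ v α, φ (b • v) α = φ v (α - β) := by
  induction β using aux_zind with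
  | h0 => exact ⟨1, by simp⟩
  | hadd a b ha hb =>
    obtain ⟨a', ha⟩ := ha
    obtain ⟨b', hb⟩ := hb
    exact ⟨a' * b', fun v α => by rw [mul_smul, ha, hb, sub_sub]⟩
  | h1 i => exact ⟨_, G.hI i⟩
  | hm i => exact ⟨_, fun v α => by rw [G.hD i, Pi.single_neg, sub_neg_eq_add]⟩

lemma shift_single (β α : Fin n → ℤ) (x : N) : ∃ b : In K n, b • φ.symm (Finsupp.single α x) =
    φ.symm (Finsupp.single β x) := by
  obtain ⟨b, hb⟩ := G.shift (β - α)
  refine ⟨b, φ.injective (Finsupp.ext fun δ => ?_)⟩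
  rw [hb, LinearEquiv.apply_symm_apply, LinearEquiv.apply_symm_apply]
  by_cases h : δ = β
  · subst h; simp
  · rw [Finsupp.single_eq_of_ne h, Finsupp.single_eq_of_ne]
    intro h'
    apply h
    rw [← sub_eq_zero] at h' ⊢
    rw [← h']
    abel

lemma D_single (d : Dn K n) (x : N) : dnVal K n d • φ.symm (Finsupp.single 0 x) =
    φ.symm (Finsupp.single 0 (d • x)) := by
  obtain ⟨p, rfl⟩ := piD_surj K n d
  induction p using MvPolynomial.induction_on generalizing x with
  | C c =>
    rw [piD, MvPolynomial.aeval_C, dnVal_algebraMap, algebraMap_smul, algebraMap_smul, ← map_smul,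
      Finsupp.smul_single]
  | add p q hp hq =>
    rw [map_add, map_add, add_smul, hp, hq, add_smul, Finsupp.single_add, map_add]
  | mul_X p i hp =>
    rw [map_mul, map_mul, mul_smul]
    have : (piD K n (MvPolynomial.X i)) = HElD K n i := by
      rw [piD, MvPolynomial.aeval_X]
    have h2 : dnVal K n (HElD K n i) • φ.symm (Finsupp.single 0 x) =
        φ.symm (Finsupp.single 0 (HElD K n i • x)) := by
      apply φ.injective
      ext α
      rw [show dnVal K n (HElD K n i) = HEl K n i from rfl, G.hH, LinearEquiv.apply_symm_apply,
        LinearEquiv.apply_symm_apply]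
      by_cases h : α = 0
      · subst h; simp
      · rw [Finsupp.single_eq_of_ne h, Finsupp.single_eq_of_ne h, smul_zero]
    rw [this, h2, hp, dn_mul_smul]

/-- degree zero part of a submodule -/
def deg0 (W : Submodule (In K n) M) : Submodule (Dn K n) N where
  carrier := {x | φ.symm (Finsupp.single 0 x) ∈ W}
  zero_mem' := by simp
  add_mem' := by
    intro a b ha hb
    rw [Set.mem_ofPred_eq, Finsupp.single_add, map_add]
    exact add_mem ha hb
  smul_mem' := by
    intro d x hx
    rw [Set.mem_ofPred_eq, ← G.D_single]
    exact W.smul_mem _ hx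

/-- submodule induced from a submodule -/
def ofDeg0 (J : Submodule (Dn K n) N) : Submodule (In K n) M where
  carrier := {v | ∀ α, φ v α ∈ J}
  zero_mem' := by simp
  add_mem' := by
    intro a b ha hb α
    rw [map_add]
    exact add_mem (ha α) (hb α)
  smul_mem' := by
    intro a
    induction a using aux_ind with
    | hi i => intro v hv α; rw [G.hI]; exact hv _
    | hd i => intro v hv α; rw [G.hD]; exact hv _
    | hx i =>
      intro v hv α
      rw [rel_x, mul_smul, G.hI, G.hH]
      exact J.smul_mem _ (hv _)
    | hc c =>
      intro v hv α
      rw [algebraMap_smul, map_smul, Finsupp.smul_apply, ← algebraMap_smul (Dn K n) c]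
      exact J.smul_mem _ (hv _)
    | ha a b ha hb =>
      intro v hv α
      rw [add_smul, map_add]
      exact add_mem (ha hv α) (hb hv α)
    | hm a b ha hb =>
      intro v hv
      rw [mul_smul]
      exact ha (hb hv)

lemma graded (W : Submodule (In K n) M) (m : ℕ) : ∀ v ∈ W, (φ v).support.card ≤ m →
    ∀ α, φ v α ∈ G.deg0 W := by
  induction m with
  | zero =>
    intro v hv h α
    have : φ v = 0 := by simpa using h
    rw [this]
    exact zero_mem _
  | succ m ih =>
    intro v hv h α
    by_cases hs : ∃ β ∈ (φ v).support, β ≠ α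
    · obtain ⟨β, hβ, hne⟩ := hs
      obtain ⟨i, hi⟩ := Function.ne_iff.mp hne
      have key := ih ((HEl K n i - algebraMap K _ (lam i + β i)) ^ k • v) (W.smul_mem _ hv) (by
        have : (φ ((HEl K n i - algebraMap K _ (lam i + β i)) ^ k • v)).support ⊆ (φ v).support.erase β := by
          intro δ hδ
          rw [Finsupp.mem_support_iff, G.pow_apply] at hδ
          rw [Finset.mem_erase, Finsupp.mem_support_iff]
          constructor
          · rintro rfl
            rw [add_sub_cancel_right, G.hnil] at hδ
            exact hδ rfl
          · intro h0
            rw [h0, smul_zero] at hδ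
            exact hδ rfl
        have h2 := Finset.card_le_card this
        rw [Finset.card_erase_of_mem hβ] at h2
        omega) α
      rw [G.pow_apply] at key
      refine aux_cancel (G.hnil i) _ _ ?_ k _ key
      intro h
      apply hi
      have : (β i : K) = α i := by linear_combination h
      exact_mod_cast this
    · push Not at hs
      have hv' : v = φ.symm (Finsupp.single α (φ v α)) := by
        apply φ.injective
        rw [LinearEquiv.apply_symm_apply]
        ext δ
        by_cases hδ : δ = α
        · rw [hδ, Finsupp.single_eq_same]
        · rw [Finsupp.single_eq_of_ne hδ]
          by_contra h0
          exact hδ (hs δ (Finsupp.mem_support_iff.mpr h0))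
      obtain ⟨b, hb⟩ := G.shift_single 0 α (φ v α)
      show φ.symm (Finsupp.single 0 (φ v α)) ∈ W
      rw [← hb, ← hv']
      exact W.smul_mem _ hv

/-- lattice isomorphism -/
def iso : Submodule (In K n) M ≃o Submodule (Dn K n) N where
  toFun W := G.deg0 W
  invFun J := G.ofDeg0 J
  left_inv W := by
    ext v
    constructor
    · intro hv
      have : v = ∑ α ∈ (φ v).support, φ.symm (Finsupp.single α (φ v α)) := by
        rw [← map_sum]
        apply φ.injective
        rw [LinearEquiv.apply_symm_apply]
        exact (Finsupp.sum_single (φ v)).symm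
      rw [this]
      refine sum_mem fun α _ => ?_
      obtain ⟨b, hb⟩ := G.shift_single α 0 (φ v α)
      rw [← hb]
      exact W.smul_mem _ (hv α)
    · intro hv
      exact G.graded W _ v hv le_rfl
  right_inv J := by
    ext x
    constructor
    · intro h
      have := h 0
      rwa [LinearEquiv.apply_symm_apply, Finsupp.single_eq_same] at this
    · intro h α
      rw [LinearEquiv.apply_symm_apply]
      by_cases hα : α = 0
      · rwa [hα, Finsupp.single_eq_same]
      · rw [Finsupp.single_eq_of_ne hα]; exact zero_mem _
  map_rel_iff' := by
    intro W W'
    constructor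
    · intro h v hv
      have : v = ∑ α ∈ (φ v).support, φ.symm (Finsupp.single α (φ v α)) := by
        rw [← map_sum]
        apply φ.injective
        rw [LinearEquiv.apply_symm_apply]
        exact (Finsupp.sum_single (φ v)).symm
      rw [this]
      refine sum_mem fun α _ => ?_
      obtain ⟨b, hb⟩ := G.shift_single α 0 (φ v α)
      rw [← hb]
      exact W'.smul_mem _ (h (G.graded W _ v hv le_rfl α))
    · intro h x hx
      exact h hx

lemma covBy_finrank [FiniteDimensional K N] {p q : Submodule (Dn K n) N} (h : p ⋖ q) :
    Module.finrank K q = Module.finrank K p + 1 := by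
  have hle : ∀ i, ∀ x ∈ q, (HElD K n i - algebraMap K _ (lam i)) • x ∈ p := by
    intro i
    let f : N →ₗ[Dn K n] N := LinearMap.lsmul (Dn K n) N (HElD K n i - algebraMap K _ (lam i))
    have hpow : ∀ m (x : N), (f ^ m) x = (HElD K n i - algebraMap K _ (lam i)) ^ m • x := by
      intro m
      induction m with
      | zero => simp
      | succ m ih => intro x; rw [pow_succ', Module.End.mul_apply, ih, pow_succ', dn_mul_smul]; rfl
    have h1 : p ≤ p ⊔ q.map f := le_sup_left
    have hmq : q.map f ≤ q := by
      rintro _ ⟨x, hx, rfl⟩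
      exact q.smul_mem _ hx
    have h2 : p ⊔ q.map f ≤ q := sup_le h.le hmq
    rcases h.eq_or_eq h1 h2 with h3 | h3
    · intro x hx
      rw [← h3]
      exact Submodule.mem_sup_right ⟨x, hx, rfl⟩
    · exfalso
      have : ∀ m, q ≤ p ⊔ q.map (f ^ m) := by
        intro m
        induction m with
        | zero =>
          intro x hx
          exact Submodule.mem_sup_right ⟨x, hx, by simp⟩
        | succ m ih =>
          intro x hx
          rw [← h3] at hx
          obtain ⟨y, hy, z, ⟨w, hw, rfl⟩, rfl⟩ := Submodule.mem_sup.mp hx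
          obtain ⟨y', hy', z', ⟨w', hw', rfl⟩, rfl⟩ := Submodule.mem_sup.mp (ih hw)
          rw [map_add, ← add_assoc]
          refine add_mem (add_mem (Submodule.mem_sup_left hy) (Submodule.mem_sup_left (p.smul_mem _ hy')))
            (Submodule.mem_sup_right ⟨w', hw', ?_⟩)
          rw [pow_succ']; rfl
      refine absurd (this k) (not_le_of_gt (lt_of_le_of_lt ?_ h.lt))
      refine sup_le le_rfl ?_
      rintro _ ⟨x, hx, rfl⟩
      rw [hpow, G.hnil]
      exact zero_mem _
  obtain ⟨x, hxq, hxp⟩ := SetLike.exists_of_lt h.lt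
  have hD : ∀ d : Dn K n, ∃ c : K, d • x - c • x ∈ p := by
    intro d
    obtain ⟨P, rfl⟩ := piD_surj K n d
    induction P using MvPolynomial.induction_on with
    | C c =>
      refine ⟨c, ?_⟩
      rw [piD, MvPolynomial.aeval_C, algebraMap_smul, sub_self]
      exact zero_mem _
    | add P Q hP hQ =>
      obtain ⟨a, ha⟩ := hP
      obtain ⟨b, hb⟩ := hQ
      refine ⟨a + b, ?_⟩
      rw [map_add, add_smul, add_smul, add_sub_add_comm]
      exact add_mem ha hb
    | mul_X P i hP =>
      obtain ⟨a, ha⟩ := hP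
      refine ⟨lam i * a, ?_⟩
      have e : (piD K n (MvPolynomial.X i)) = HElD K n i := by
        rw [piD, MvPolynomial.aeval_X]
      have h1 := hle i _ (q.smul_mem (piD K n P) hxq)
      have h2 := p.smul_mem (algebraMap K (Dn K n) (lam i)) ha
      have := add_mem h1 h2
      rw [map_mul, e]
      convert this using 1
      rw [sub_smul, smul_sub, algebraMap_smul, algebraMap_smul, mul_smul, mul_comm, dn_mul_smul]
      abel
  have hq : q.restrictScalars K = p.restrictScalars K ⊔ Submodule.span K {x} := by
    apply le_antisymm
    · have h4 : p ⊔ Submodule.span (Dn K n) {x} = q := by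
        refine (h.eq_or_eq le_sup_left (sup_le h.le ?_)).resolve_left ?_
        · rwa [Submodule.span_singleton_le_iff_mem]
        · intro h5
          apply hxp
          rw [← h5]
          exact Submodule.mem_sup_right (Submodule.mem_span_singleton_self x)
      intro y hy
      rw [Submodule.restrictScalars_mem, ← h4] at hy
      obtain ⟨a, ha, b, hb, rfl⟩ := Submodule.mem_sup.mp hy
      obtain ⟨d, rfl⟩ := Submodule.mem_span_singleton.mp hb
      obtain ⟨c, hc⟩ := hD d
      refine Submodule.mem_sup.mpr ⟨a + (d • x - c • x), add_mem ha hc, c • x,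
        Submodule.smul_mem _ _ (Submodule.mem_span_singleton_self x), by abel⟩
    · refine sup_le (fun y hy => h.le hy) ?_
      rw [Submodule.span_singleton_le_iff_mem]
      exact hxq
  have hx0 : x ≠ 0 := by rintro rfl; exact hxp (zero_mem _)
  have hdisj : p.restrictScalars K ⊓ Submodule.span K {x} = ⊥ := by
    rw [← disjoint_iff, Submodule.disjoint_span_singleton' hx0]
    exact hxp
  have := Submodule.finrank_sup_add_finrank_inf_eq (p.restrictScalars K) (Submodule.span K {x})
  rw [← hq, hdisj, finrank_bot, finrank_span_singleton hx0] at this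
  exact this

lemma series [FiniteDimensional K N] : ∃ s : CompositionSeries (Submodule (In K n) M),
      s.head = ⊥ ∧ s.last = ⊤ ∧ s.length = Module.finrank K N := by
  have : IsNoetherian (Dn K n) N := isNoetherian_of_tower K inferInstance
  have : IsArtinian (Dn K n) N := isArtinian_of_tower K inferInstance
  obtain ⟨s, h1, h2⟩ := exists_compositionSeries_of_isNoetherian_isArtinian (Dn K n) N
  have hl : ∀ i : ℕ, ∀ hi : i < s.length + 1, Module.finrank K (s ⟨i, hi⟩) = i := by
    intro i
    induction i with
    | zero =>
      intro hi
      have : s ⟨0, hi⟩ = ⊥ := h1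
      rw [this]
      exact finrank_bot K N
    | succ i ih =>
      intro hi
      have hc : s ⟨i, by omega⟩ ⋖ s ⟨i + 1, hi⟩ := s.step ⟨i, by omega⟩
      rw [G.covBy_finrank hc, ih]
  refine ⟨⟨s.length, fun i => G.iso.symm (s i), fun i => ?_⟩, ?_, ?_, ?_⟩
  · have hc : s i.castSucc ⋖ s i.succ := s.step i
    exact (apply_covBy_apply_iff G.iso.symm).mpr hc
  · show G.iso.symm s.head = ⊥
    rw [h1, map_bot]
  · show G.iso.symm s.last = ⊤
    rw [h2, map_top]
  · show s.length = _
    have h3 := hl s.length (by omega)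
    have h4 : s ⟨s.length, by omega⟩ = ⊤ := h2
    rw [h4] at h3
    rw [← h3]
    exact finrank_top K N

end Good

end Aux3
noncomputable section Aux4

variable (K : Type*) [Field K] [CharZero K] (n : ℕ)

lemma toBn_int (i : Fin n) : toBn K n (intEl K n i) = uu K n (Pi.single i 1) := by
  rw [uu_single, zpow_one]; rfl

lemma toBn_d (i : Fin n) : toBn K n (dEl K n i) = uu K n (Pi.single i (-1)) := by
  rw [uu_single, zpow_neg, zpow_one]; rfl

/-- shift automorphism -/
def sh (α : Fin n → ℤ) : Dn K n →ₐ[K] Dn K n :=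
  (MvPolynomial.aeval (fun i => HElD K n i + algebraMap K _ (α i : K))).comp
    (AlgEquiv.ofBijective (piD K n) ⟨piD_inj K n, piD_surj K n⟩).symm.toAlgHom

lemma sh_piD (α : Fin n → ℤ) (p) : sh K n α (piD K n p) =
    MvPolynomial.aeval (fun i => HElD K n i + algebraMap K _ (α i : K)) p := by
  have : (AlgEquiv.ofBijective (piD K n) ⟨piD_inj K n, piD_surj K n⟩).symm (piD K n p) = p :=
    (AlgEquiv.ofBijective (piD K n) ⟨piD_inj K n, piD_surj K n⟩).symm_apply_apply p
  show MvPolynomial.aeval _ ((AlgEquiv.ofBijective (piD K n) ⟨piD_inj K n, piD_surj K n⟩).symm (piD K n p)) = _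
  rw [this]

lemma sh_uu (d : Dn K n) (α : Fin n → ℤ) : bnD K n d * uu K n α = uu K n α * bnD K n (sh K n α d) := by
  obtain ⟨p, rfl⟩ := piD_surj K n d
  rw [sh_piD, p_uu]

lemma evD_sh (d : Dn K n) (α : Fin n → ℤ) (mu : Fin n → K) :
    evD K n mu (sh K n α d) = evD K n (fun i => mu i + α i) d := by
  obtain ⟨p, rfl⟩ := piD_surj K n d
  rw [sh_piD]
  induction p using MvPolynomial.induction_on with
  | C c => rw [MvPolynomial.aeval_C, evD_piD, MvPolynomial.eval_C, AlgHom.commutes]; rfl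
  | add p q hp hq => simp only [map_add, hp, hq]
  | mul_X p i hp =>
    rw [map_mul, map_mul, map_mul, map_mul, hp, MvPolynomial.aeval_X, map_add, evD_H, AlgHom.commutes]
    congr 1
    rw [evD_piD, MvPolynomial.eval_X]; rfl

lemma repr_single (α : Fin n → ℤ) (d : Dn K n) :
    (bB K n).repr (uu K n α * bnD K n d) = Finsupp.single α d := by
  rw [← bn_smul_def, ← bB_apply, map_smul, Module.Basis.repr_self, Finsupp.smul_single, smul_eq_mul, mul_one]

lemma bn_ind {p : Bn K n → Prop} (h0 : p 0) (hadd : ∀ a b, p a → p b → p (a + b))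
    (hs : ∀ α d, p (uu K n α * bnD K n d)) (b : Bn K n) : p b := by
  obtain ⟨f, rfl⟩ := (bB K n).repr.symm.surjective b
  induction f using Finsupp.induction_linear with
  | zero => rw [map_zero]; exact h0
  | add f g hf hg => rw [map_add]; exact hadd _ _ hf hg
  | single α d =>
    rw [← repr_single, LinearEquiv.symm_apply_apply]
    exact hs α d

lemma repr_mul_uu (b : Bn K n) (α β : Fin n → ℤ) :
    (bB K n).repr (b * uu K n β) (α + β) = sh K n β ((bB K n).repr b α) := by
  induction b using bn_ind with
  | h0 => simp
  | hadd a b ha hb => rw [add_mul, map_add (bB K n).repr, map_add (bB K n).repr, Finsupp.add_apply, Finsupp.add_apply, ha, hb, map_add]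
  | hs γ d =>
    rw [mul_assoc, sh_uu, ← mul_assoc, ← Units.val_mul, ← uu_add, repr_single, repr_single]
    by_cases h : γ = α
    · subst h; simp
    · rw [Finsupp.single_eq_of_ne (Ne.symm h), Finsupp.single_eq_of_ne, map_zero]
      intro h'; exact h (add_right_cancel h').symm

section
variable {N : Type*} [AddCommGroup N] [Module K N] [Module (Dn K n) N] [IsScalarTower K (Dn K n) N]

/-- pure tensors -/
def tm (b : Bn K n) (x : N) : Ind K n N := b ⊗ₜ[Dn K n] x

lemma smul_tm (a : In K n) (b : Bn K n) (x : N) : a • tm K n b x = tm K n (toBn K n a * b) x := rfl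

lemma bsmul_tm (a : Bn K n) (b : Bn K n) (x : N) : a • tm K n b x = tm K n (a * b) x := rfl

lemma tm_ind {p : Ind K n N → Prop} (h0 : p 0) (hadd : ∀ a b, p a → p b → p (a + b))
    (hs : ∀ α x, p (tm K n (uu K n α) x)) (v : Ind K n N) : p v := by
  refine TensorProduct.induction_on (motive := p) v h0 ?_ hadd
  intro b x
  induction b using bn_ind with
  | h0 => rw [TensorProduct.zero_tmul]; exact h0
  | hadd a b ha hb => rw [TensorProduct.add_tmul]; exact hadd _ _ ha hb
  | hs α d =>
    rw [← bn_smul_def, TensorProduct.smul_tmul]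
    exact hs α _

variable (N) in
/-- coordinates on the induced module -/
def phi : Ind K n N ≃ₗ[K] ((Fin n → ℤ) →₀ N) :=
  { (TensorProduct.equivFinsuppOfBasisLeft (bB K n) :
      (Bn K n) ⊗[Dn K n] N ≃ₗ[Dn K n] ((Fin n → ℤ) →₀ N)) with
    map_smul' := by
      intro c v
      have h := map_smul (TensorProduct.equivFinsuppOfBasisLeft (bB K n) :
        (Bn K n) ⊗[Dn K n] N ≃ₗ[Dn K n] ((Fin n → ℤ) →₀ N)) (algebraMap K (Dn K n) c) v
      refine h.trans ?_
      ext α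
      exact algebraMap_smul (Dn K n) c _ }

lemma phi_tm (b : Bn K n) (x : N) (α : Fin n → ℤ) : phi K n N (tm K n b x) α = (bB K n).repr b α • x :=
  TensorProduct.equivFinsuppOfBasisLeft_apply_tmul_apply _ _ _ _

lemma phi_uu (x : N) (α : Fin n → ℤ) : phi K n N (tm K n (uu K n α) x) = Finsupp.single α x := by
  ext β
  rw [phi_tm, ← bB_apply, Module.Basis.repr_self]
  by_cases h : β = α
  · subst h; simp
  · rw [Finsupp.single_eq_of_ne h, Finsupp.single_eq_of_ne h, zero_smul]

lemma phi_good {lam : Fin n → K} {k : ℕ}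
    (hnil : ∀ i (x : N), (HElD K n i - algebraMap K _ (lam i)) ^ k • x = 0) :
    Good (phi K n N) lam k where
  hnil := hnil
  hH := by
    intro i v α
    induction v using tm_ind with
    | h0 => simp
    | hadd a b ha hb => simp only [smul_add, map_add, Finsupp.add_apply, ha, hb]
    | hs β x =>
      rw [smul_tm, ← bnD_H, H_uu, ← bn_smul_def, phi_uu]
      rw [show tm K n ((HElD K n i + algebraMap K _ (β i : K)) • (uu K n β : Bn K n)) x =
        tm K n (uu K n β) ((HElD K n i + algebraMap K _ (β i : K)) • x) from TensorProduct.smul_tmul _ _ _, phi_uu]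
      by_cases h : α = β
      · subst h; simp
      · rw [Finsupp.single_eq_of_ne h, Finsupp.single_eq_of_ne h, smul_zero]
  hI := by
    intro i v α
    induction v using tm_ind with
    | h0 => simp
    | hadd a b ha hb => simp only [smul_add, map_add, Finsupp.add_apply, ha, hb]
    | hs β x =>
      rw [smul_tm, toBn_int, ← Units.val_mul, ← uu_add, phi_uu, phi_uu]
      by_cases h : α - Pi.single i 1 = β
      · subst h; rw [add_sub_cancel]; simp
      · rw [Finsupp.single_eq_of_ne h, Finsupp.single_eq_of_ne]
        rintro rfl; apply h; abel
  hD := by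
    intro i v α
    induction v using tm_ind with
    | h0 => simp
    | hadd a b ha hb => simp only [smul_add, map_add, Finsupp.add_apply, ha, hb]
    | hs β x =>
      rw [smul_tm, toBn_d, ← Units.val_mul, ← uu_add, phi_uu, phi_uu]
      have e : (Pi.single i (-1) : Fin n → ℤ) = - Pi.single i 1 := by rw [Pi.single_neg]
      rw [e]
      by_cases h : α + Pi.single i 1 = β
      · subst h; rw [show -Pi.single i 1 + (α + Pi.single i 1) = α by abel]; simp
      · rw [Finsupp.single_eq_of_ne h, Finsupp.single_eq_of_ne]
        rintro rfl; apply h; abel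

end

lemma sub_evD (mu : Fin n → K) (d : Dn K n) : d - algebraMap K _ (evD K n mu d) ∈ mIdeal K n mu := by
  obtain ⟨p, rfl⟩ := piD_surj K n d
  induction p using MvPolynomial.induction_on with
  | C c => 
    rw [evD_piD, MvPolynomial.eval_C, piD, MvPolynomial.aeval_C, sub_self]; exact zero_mem _
  | add p q hp hq =>
    rw [map_add, map_add, map_add, add_sub_add_comm]; exact add_mem hp hq
  | mul_X p i hp =>
    have e : (piD K n (MvPolynomial.X i)) = HElD K n i := by
      rw [piD, MvPolynomial.aeval_X]
    rw [map_mul, map_mul, map_mul, e, evD_H]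
    have h1 : HElD K n i - algebraMap K (Dn K n) (mu i) ∈ mIdeal K n mu :=
      Ideal.subset_span ⟨i, rfl⟩
    have h2 := add_mem (Ideal.mul_mem_left _ (piD K n p) h1)
      (Ideal.mul_mem_left _ (algebraMap K (Dn K n) (mu i)) hp)
    convert h2 using 1
    ring

lemma unit_mod {mu : Fin n → K} {I : Ideal (Dn K n)} {k : ℕ} (hmk : mIdeal K n mu ^ k ≤ I)
    (d : Dn K n) (hd : evD K n mu d ≠ 0) : ∃ e, e * d - 1 ∈ I := by
  obtain ⟨q, hq⟩ := sub_dvd_pow_sub_pow (d - algebraMap K _ (evD K n mu d)) (- algebraMap K _ (evD K n mu d)) k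
  have h1 : (d - algebraMap K _ (evD K n mu d)) ^ k ∈ I := hmk (Ideal.pow_mem_pow (sub_evD K n mu d) k)
  have h2 : (algebraMap K (Dn K n) ((-(evD K n mu d))^k)⁻¹) * (- algebraMap K _ (evD K n mu d)) ^ k = 1 := by
    rw [← map_neg (algebraMap K (Dn K n)), ← map_pow (algebraMap K (Dn K n)), ← map_mul, inv_mul_cancel₀ (pow_ne_zero _ (neg_ne_zero.mpr hd)), map_one]
  set c := (algebraMap K (Dn K n) ((-(evD K n mu d))^k)⁻¹)
  refine ⟨- c * q, ?_⟩
  have h3 := I.mul_mem_left (-c) h1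
  convert h3 using 1
  linear_combination c * hq + h2

variable {K n} {lam : Fin n → K} {I : Ideal (Dn K n)} {k : ℕ}

lemma q_hnil (hmk : mIdeal K n lam ^ k ≤ I) (i) (x : Dn K n ⧸ I) :
    (HElD K n i - algebraMap K _ (lam i)) ^ k • x = 0 := by
  obtain ⟨d, rfl⟩ := Ideal.Quotient.mk_surjective x
  have h1 : HElD K n i - algebraMap K (Dn K n) (lam i) ∈ mIdeal K n lam :=
      Ideal.subset_span ⟨i, rfl⟩
  have h2 := I.mul_mem_right d (hmk (Ideal.pow_mem_pow h1 k))
  exact Ideal.Quotient.eq_zero_iff_mem.mpr h2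

lemma q_fin (hmk : mIdeal K n lam ^ k ≤ I) : FiniteDimensional K (Dn K n ⧸ I) := by
  let f : MvPolynomial (Fin n) K →ₐ[K] (Dn K n ⧸ I) := (Ideal.Quotient.mkₐ K I).comp (piD K n)
  have hf : Function.Surjective f := (Ideal.Quotient.mkₐ_surjective K I).comp (piD_surj K n)
  have hr : Algebra.adjoin K (Set.range fun i => f (MvPolynomial.X i)) = ⊤ := by
    rw [← AlgHom.range_eq_top] at hf
    rw [← hf, ← Algebra.map_top, ← MvPolynomial.adjoin_range_X, AlgHom.map_adjoin, ← Set.range_comp]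
    rfl
  have hint : ∀ x ∈ Set.range (fun i => f (MvPolynomial.X i)), IsIntegral K x := by
    rintro _ ⟨i, rfl⟩
    have h1 : HElD K n i - algebraMap K (Dn K n) (lam i) ∈ mIdeal K n lam :=
      Ideal.subset_span ⟨i, rfl⟩
    refine ⟨(Polynomial.X - Polynomial.C (lam i)) ^ k, (Polynomial.monic_X_sub_C _).pow k, ?_⟩
    have e : (piD K n (MvPolynomial.X i)) = HElD K n i := by
      rw [piD, MvPolynomial.aeval_X]
    have h2 := Ideal.Quotient.eq_zero_iff_mem.mpr (hmk (Ideal.pow_mem_pow h1 k))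
    rw [← h2]
    simp only [Polynomial.eval₂_pow, Polynomial.eval₂_sub, Polynomial.eval₂_X, Polynomial.eval₂_C, map_pow, map_sub]
    rw [← e]
    rfl
  have := fg_adjoin_of_finite (Set.finite_range _) hint
  rw [hr] at this
  exact ⟨this⟩

lemma q_nontriv (hIm : I ≤ mIdeal K n lam) : Nontrivial (Dn K n ⧸ I) := by
  apply Ideal.Quotient.nontrivial_iff.mpr
  rintro rfl
  have := mIdeal_evD K n lam 1 (hIm trivial)
  rw [map_one] at this
  exact one_ne_zero this

lemma q_indec (hmk : mIdeal K n lam ^ k ≤ I) (p q : Submodule (Dn K n) (Dn K n ⧸ I)) (h : IsCompl p q) :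
    p = ⊥ ∨ q = ⊥ := by
  have key : ∀ (r : Submodule (Dn K n) (Dn K n ⧸ I)) (a : Dn K n), Ideal.Quotient.mk I a ∈ r →
      evD K n lam a ≠ 0 → r = ⊤ := by
    intro r a ha h0
    obtain ⟨e, he⟩ := unit_mod K n hmk a h0
    have h1 : Ideal.Quotient.mk I (e * a) = Ideal.Quotient.mk I 1 := Ideal.Quotient.eq.mpr he
    have h2 : Ideal.Quotient.mk I (e * a) ∈ r := r.smul_mem e ha
    rw [h1] at h2
    rw [eq_top_iff]
    intro x _
    obtain ⟨d, rfl⟩ := Ideal.Quotient.mk_surjective x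
    have h3 := r.smul_mem d h2
    have : d • Ideal.Quotient.mk I 1 = Ideal.Quotient.mk I d := by
      show Ideal.Quotient.mk I (d * 1) = _
      rw [mul_one]
    rwa [this] at h3
  have h1 : Ideal.Quotient.mk I 1 ∈ p ⊔ q := by rw [h.sup_eq_top]; trivial
  obtain ⟨a, ha, b, hb, hab⟩ := Submodule.mem_sup.mp h1
  obtain ⟨a, rfl⟩ := Ideal.Quotient.mk_surjective a
  obtain ⟨b, rfl⟩ := Ideal.Quotient.mk_surjective b
  by_cases hI : evD K n lam a = 0
  · by_cases hI' : evD K n lam (1 - a) = 0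
    · rw [map_sub, hI, map_one, sub_zero] at hI'
      exact absurd hI' one_ne_zero
    · left
      have : q = ⊤ := key q (1 - a) (by rw [map_sub, ← hab, add_sub_cancel_left]; exact hb) hI'
      have h2 := h.inf_eq_bot
      rwa [this, inf_top_eq] at h2
  · right
    have := key p a ha hI
    have h2 := h.inf_eq_bot
    rwa [this, top_inf_eq] at h2

lemma q_indec' (hIm : I ≤ mIdeal K n lam) (hmk : mIdeal K n lam ^ k ≤ I) :
    IsIndecomposableMod K n (Ind K n (Dn K n ⧸ I)) := by
  have G := phi_good K n (N := Dn K n ⧸ I) (q_hnil hmk)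
  have := q_nontriv hIm
  refine ⟨(phi K n (Dn K n ⧸ I)).toEquiv.nontrivial, fun p q hpq => ?_⟩
  have h : IsCompl (G.iso p) (G.iso q) := G.iso.isCompl hpq
  rcases q_indec hmk _ _ h with h | h
  · left; exact (map_eq_bot_iff G.iso).mp h
  · right; exact (map_eq_bot_iff G.iso).mp h

lemma bn_repr_mem (b : Bn K n) (h : ∀ α, (bB K n).repr b α ∈ I) :
    b ∈ Submodule.span (Bn K n) (bnD K n '' (I : Set (Dn K n))) := by
  rw [← (bB K n).linearCombination_repr b, Finsupp.linearCombination_apply]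
  refine Submodule.sum_mem _ fun α _ => ?_
  show bB K n α * bnD K n _ ∈ _
  exact Submodule.smul_mem _ (bB K n α) (Submodule.subset_span ⟨_, h α, rfl⟩)

variable (I) in
/-- `b ↦ b ⊗ 1` -/
def qmap : Bn K n →ₗ[Bn K n] Ind K n (Dn K n ⧸ I) :=
  LinearMap.toSpanSingleton (Bn K n) _ (tm K n 1 (Ideal.Quotient.mk I 1))

lemma qmap_apply (b : Bn K n) : qmap I b = tm K n b (Ideal.Quotient.mk I 1) := by
  rw [qmap, LinearMap.toSpanSingleton_apply, bsmul_tm, mul_one]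

lemma smul_mk_one (d : Dn K n) : d • Ideal.Quotient.mk I 1 = Ideal.Quotient.mk I d := by
  show Ideal.Quotient.mk I (d * 1) = _
  rw [mul_one]

lemma qmap_ker : LinearMap.ker (qmap I) = Submodule.span (Bn K n) (bnD K n '' (I : Set (Dn K n))) := by
  apply le_antisymm
  · intro b hb
    rw [LinearMap.mem_ker, qmap_apply] at hb
    apply bn_repr_mem
    intro α
    have := phi_tm K n b (Ideal.Quotient.mk I 1) α
    rw [hb, map_zero, Finsupp.zero_apply, smul_mk_one] at this
    exact Ideal.Quotient.eq_zero_iff_mem.mp this.symm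
  · rw [Submodule.span_le]
    rintro _ ⟨d, hd, rfl⟩
    show qmap I (bnD K n d) = 0
    rw [qmap_apply]
    apply (phi K n (Dn K n ⧸ I)).injective
    have : tm K n (bnD K n d) (Ideal.Quotient.mk I 1) = tm K n 1 (d • (Ideal.Quotient.mk I 1)) := by
      rw [← one_mul (bnD K n d), ← bn_smul_def]
      exact TensorProduct.smul_tmul _ _ _
    rw [this, smul_mk_one, Ideal.Quotient.eq_zero_iff_mem.mpr hd]
    exact congrArg _ (TensorProduct.tmul_zero _ _)

lemma qmap_surj : Function.Surjective (qmap I) := by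
  intro v
  refine tm_ind K n (p := fun v => ∃ a, qmap I a = v) ⟨0, map_zero _⟩ ?_ ?_ v
  · rintro _ _ ⟨a, rfl⟩ ⟨b, rfl⟩
    exact ⟨a + b, map_add _ _ _⟩
  · intro α x
    obtain ⟨d, rfl⟩ := Ideal.Quotient.mk_surjective x
    refine ⟨uu K n α * bnD K n d, ?_⟩
    rw [qmap_apply, ← bn_smul_def, ← smul_mk_one]
    exact TensorProduct.smul_tmul _ _ _

lemma q_equiv : Nonempty ((Ind K n (Dn K n ⧸ I)) ≃ₗ[In K n]
      (Bn K n ⧸ Submodule.span (Bn K n) (bnD K n '' (I : Set (Dn K n))))) := by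
  let e : (Bn K n ⧸ Submodule.span (Bn K n) (bnD K n '' (I : Set (Dn K n)))) ≃ₗ[Bn K n]
      Ind K n (Dn K n ⧸ I) :=
    (Submodule.quotEquivOfEq _ _ qmap_ker.symm).trans ((qmap I).quotKerEquivOfSurjective qmap_surj)
  refine ⟨{ e.symm with map_smul' := ?_ }⟩
  intro a v
  exact map_smul e.symm (toBn K n a) v

lemma poly_zero_lat (mu : Fin n → K) (p : MvPolynomial (Fin n) K)
    (h : ∀ β : Fin n → ℤ, MvPolynomial.eval (fun i => mu i + β i) p = 0) : p = 0 := by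
  refine MvPolynomial.funext_set (fun i => Set.range fun z : ℤ => mu i + z) (fun i => ?_) ?_
  · apply Set.infinite_range_of_injective
    intro a b hab
    simpa using hab
  · intro x hx
    have : ∀ i, ∃ z : ℤ, mu i + z = x i := fun i => hx i trivial
    choose β hβ using this
    rw [map_zero, ← h β]
    congr 1
    exact congrArg _ (funext fun i => (hβ i).symm)

lemma q_ann (hIm : I ≤ mIdeal K n lam) :
    annSet K n (Ind K n (Dn K n ⧸ I)) = (aFull K n : Set (In K n)) := by
  ext a
  rw [SetLike.mem_coe, ← toBn_eq_zero]
  constructor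
  · intro h
    have h2 : ∀ α, (bB K n).repr (toBn K n a) α = 0 := by
      intro α
      obtain ⟨p, hp⟩ := piD_surj K n ((bB K n).repr (toBn K n a) α)
      rw [← hp]
      suffices p = 0 by rw [this, map_zero]
      apply poly_zero_lat lam
      intro β
      rw [← evD_piD, ← evD_sh, hp, ← repr_mul_uu]
      apply mIdeal_evD
      apply hIm
      have h3 := h (tm K n (uu K n β) (Ideal.Quotient.mk I 1))
      rw [smul_tm] at h3
      have := phi_tm K n (toBn K n a * uu K n β) (Ideal.Quotient.mk I 1) (α + β)
      rw [h3, map_zero, Finsupp.zero_apply, smul_mk_one] at this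
      exact Ideal.Quotient.eq_zero_iff_mem.mp this.symm
    apply (bB K n).repr.injective
    rw [map_zero]
    ext α
    exact h2 α
  · intro h m
    show toBn K n a • m = 0
    rw [h, zero_smul]

end Aux4

/-- for an orbit with `𝔻_Ω = ∅` and `𝔪 ⊇ I ⊇ 𝔪^k`, the module
`V(I) = B_n ⊗_{D_n} D_n/I` is an indecomposable equidimensional generalized weight module of
length `d = dim_K(D_n/I) < ∞`, isomorphic to `B_n/B_n I`, with `dim V(I)^𝔫 = d` on all of
`Ω` and annihilator `𝔞_n`. -/
theorem statement11 (K : Type*) [Field K] [CharZero K] (n : ℕ)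
    (lam : Fin n → K) (hnorm : IsNormalized K n lam) (hDD : DD K n lam = ∅)
    (I : Ideal (Dn K n)) (hIm : I ≤ mIdeal K n lam)
    (k : ℕ) (hk : 1 ≤ k) (hmk : mIdeal K n lam ^ k ≤ I) :
    FiniteDimensional K (Dn K n ⧸ I) ∧
    IsGenWeightModule K n (Ind K n (Dn K n ⧸ I)) ∧
    IsIndecomposableMod K n (Ind K n (Dn K n ⧸ I)) ∧
    supp K n (Ind K n (Dn K n ⧸ I)) = orbitOf K n lam ∧
    (∀ mu ∈ orbitOf K n lam,
      Module.finrank K (genWeightSpace K n (Ind K n (Dn K n ⧸ I)) mu)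
        = Module.finrank K (Dn K n ⧸ I)) ∧
    (∃ s : CompositionSeries (Submodule (In K n) (Ind K n (Dn K n ⧸ I))),
      s.head = ⊥ ∧ s.last = ⊤ ∧ s.length = Module.finrank K (Dn K n ⧸ I)) ∧
    Nonempty ((Ind K n (Dn K n ⧸ I)) ≃ₗ[In K n]
      (Bn K n ⧸ Submodule.span (Bn K n) (bnD K n '' (I : Set (Dn K n))))) ∧
    annSet K n (Ind K n (Dn K n ⧸ I)) = (aFull K n : Set (In K n)) := by
  have G := phi_good K n (N := Dn K n ⧸ I) (q_hnil hmk)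
  have := q_nontriv hIm
  have hf := q_fin hmk
  exact ⟨hf, G.isGW, q_indec' hIm hmk, G.supp_eq, G.finrank_eq, G.series, q_equiv, q_ann hIm⟩

end IDO
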